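/- arXiv:2001.01845 — 2 statements merged into one kernel-verified Lean document; each statement's English description precedes it below -/
import Mathlib

section
/- Let φ_{E_AE_B} be a pure bipartite state with d = dim(E_A) and spectral decomposition φ_{E_A} = Σ_z λ_z |z⟩⟨z| of its marginal, and let Z^u := Σ_{z} e^{2πiuz/d} |z⟩⟨z| for u = 0,…,d−1 be the associated phase (Weyl) unitaries on E_A. Let M_{E_A→B} be an arbitrary quantum channel and define σ_{BE_B} := (M ⊗ id)(φ_{E_AE_B}) and the classical-quantum state ω := (1/(n! d^n)) Σ_{π∈S(n)} Σ_{u^n∈{0,…,d−1}^n} |π⟩⟨π| ⊗ |u^n⟩⟨u^n| ⊗ (M^{⊗n} ⊗ id)( P^π Z^{u^n} φ^{⊗n}_{E_AE_B} (Z^{u^n})† (P^π)† ), where Z^{u^n} := Z^{u_1}⊗…⊗Z^{u_n} acts on E_A^n and P^π permutes the n systems E_A. Then n·I(B:E_B)_σ − I(ΠU^n : B^nE_B^n)_ω ≤ d·log(n+1), where Π,U^n denote the classical registers recording π and u^n. -/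
open scoped Kronecker ComplexOrder
open Matrix

noncomputable section

namespace QIT

/-- Base-2 logarithm of a Hermitian matrix, via the spectral theorem
(junk value `0` on non-Hermitian inputs). -/
def matLog {ι : Type*} [Fintype ι] [DecidableEq ι] (ρ : Matrix ι ι ℂ) : Matrix ι ι ℂ :=
  if h : ρ.IsHermitian then
    (h.eigenvectorUnitary : Matrix ι ι ℂ) *
      Matrix.diagonal (fun i => (Real.logb 2 (h.eigenvalues i) : ℂ)) *
      star (h.eigenvectorUnitary : Matrix ι ι ℂ)
  else 0

/-- Von Neumann entropy (base 2): `S(ρ) = -tr[ρ log ρ]`. -/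
def entropy {ι : Type*} [Fintype ι] [DecidableEq ι] (ρ : Matrix ι ι ℂ) : ℝ :=
  -(ρ * matLog ρ).trace.re

/-- Quantum relative entropy (base 2): `D(ρ‖σ) = tr[ρ (log ρ - log σ)]`. -/
def relEnt {ι : Type*} [Fintype ι] [DecidableEq ι] (ρ σ : Matrix ι ι ℂ) : ℝ :=
  (ρ * (matLog ρ - matLog σ)).trace.re

/-- A quantum state: positive semidefinite with unit trace. -/
def IsState {ι : Type*} [Fintype ι] (ρ : Matrix ι ι ℂ) : Prop :=
  ρ.PosSemidef ∧ ρ.trace = 1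

/-- A pure state: a rank-one outer product `|v⟩⟨v|`. -/
def IsPure {ι : Type*} [Fintype ι] (ρ : Matrix ι ι ℂ) : Prop :=
  ∃ v : ι → ℂ, ρ = Matrix.vecMulVec v (star v)

/-- Partial trace over the second (right) tensor factor. -/
def ptrR {α β : Type*} [Fintype β] (ρ : Matrix (α × β) (α × β) ℂ) : Matrix α α ℂ :=
  Matrix.of fun a a' => ∑ b, ρ (a, b) (a', b)

/-- Partial trace over the first (left) tensor factor. -/
def ptrL {α β : Type*} [Fintype α] (ρ : Matrix (α × β) (α × β) ℂ) : Matrix β β ℂ :=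
  Matrix.of fun b b' => ∑ a, ρ (a, b) (a, b')

/-- Quantum mutual information `I(A:B) = S(ρ_A) + S(ρ_B) - S(ρ_{AB})` (entropy form). -/
def mutualInfoS {α β : Type*} [Fintype α] [DecidableEq α] [Fintype β] [DecidableEq β]
    (ρ : Matrix (α × β) (α × β) ℂ) : ℝ :=
  entropy (ptrR ρ) + entropy (ptrL ρ) - entropy ρ

/-- Quantum mutual information `I(A:B) = D(ρ_{AB} ‖ ρ_A ⊗ ρ_B)` (relative-entropy form). -/
def mutualInfoD {α β : Type*} [Fintype α] [DecidableEq α] [Fintype β] [DecidableEq β]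
    (ρ : Matrix (α × β) (α × β) ℂ) : ℝ :=
  relEnt ρ (ptrR ρ ⊗ₖ ptrL ρ)

/-- Tensoring a linear map on matrices with the identity on the left: `id_γ ⊗ L`. -/
def lTensor {α β : Type*} (γ : Type*) (L : Matrix α α ℂ →ₗ[ℂ] Matrix β β ℂ) :
    Matrix (γ × α) (γ × α) ℂ →ₗ[ℂ] Matrix (γ × β) (γ × β) ℂ where
  toFun ρ := Matrix.of fun p q => L (Matrix.of fun a a' => ρ (p.1, a) (q.1, a')) p.2 q.2
  map_add' ρ σ := by
    ext p q
    have h : (Matrix.of fun a a' => ρ (p.1, a) (q.1, a') + σ (p.1, a) (q.1, a')) =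
        (Matrix.of fun a a' => ρ (p.1, a) (q.1, a')) +
          Matrix.of fun a a' => σ (p.1, a) (q.1, a') := rfl
    simp only [Matrix.of_apply, Matrix.add_apply, h, map_add]
  map_smul' c ρ := by
    ext p q
    have h : (Matrix.of fun a a' => c * ρ (p.1, a) (q.1, a')) =
        c • Matrix.of fun a a' => ρ (p.1, a) (q.1, a') := rfl
    simp only [Matrix.of_apply, Matrix.smul_apply, smul_eq_mul, RingHom.id_apply, h,
      _root_.map_smul]

/-- Tensoring a linear map on matrices with the identity on the right: `L ⊗ id_γ`. -/
def rTensor {α β : Type*} (γ : Type*) (L : Matrix α α ℂ →ₗ[ℂ] Matrix β β ℂ) :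
    Matrix (α × γ) (α × γ) ℂ →ₗ[ℂ] Matrix (β × γ) (β × γ) ℂ where
  toFun ρ := Matrix.of fun p q => L (Matrix.of fun a a' => ρ (a, p.2) (a', q.2)) p.1 q.1
  map_add' ρ σ := by
    ext p q
    have h : (Matrix.of fun a a' => ρ (a, p.2) (a', q.2) + σ (a, p.2) (a', q.2)) =
        (Matrix.of fun a a' => ρ (a, p.2) (a', q.2)) +
          Matrix.of fun a a' => σ (a, p.2) (a', q.2) := rfl
    simp only [Matrix.of_apply, Matrix.add_apply, h, map_add]
  map_smul' c ρ := by
    ext p q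
    have h : (Matrix.of fun a a' => c * ρ (a, p.2) (a', q.2)) =
        c • Matrix.of fun a a' => ρ (a, p.2) (a', q.2) := rfl
    simp only [Matrix.of_apply, Matrix.smul_apply, smul_eq_mul, RingHom.id_apply, h,
      _root_.map_smul]

/-- A quantum channel: a completely positive trace-preserving linear map. -/
structure QChannel (α β : Type*) [Fintype α] [DecidableEq α] [Fintype β] [DecidableEq β] where
  map : Matrix α α ℂ →ₗ[ℂ] Matrix β β ℂ
  cp : ∀ (n : ℕ) (ρ : Matrix (Fin n × α) (Fin n × α) ℂ), ρ.PosSemidef →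
    ((lTensor (Fin n) map) ρ).PosSemidef
  tp : ∀ ρ : Matrix α α ℂ, (map ρ).trace = ρ.trace

/-- The classical-quantum state `Σ_x p(x) |x⟩⟨x| ⊗ σ^x`. -/
def cqState {ι γ : Type*} [DecidableEq ι] (p : ι → ℝ) (σ : ι → Matrix γ γ ℂ) :
    Matrix (ι × γ) (ι × γ) ℂ :=
  Matrix.of fun a b => if a.1 = b.1 then (p a.1 : ℂ) * σ a.1 a.2 b.2 else 0

/-- A probability distribution on a finite alphabet. -/
def IsProbDist {ι : Type*} [Fintype ι] (p : ι → ℝ) : Prop :=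
  (∀ x, 0 ≤ p x) ∧ ∑ x, p x = 1

section Assisted

variable {EA EB A B : Type*} [Fintype EA] [DecidableEq EA] [Fintype EB] [DecidableEq EB]
  [Fintype A] [DecidableEq A] [Fintype B] [DecidableEq B]

/-- The output state `(N ∘ E ⊗ id_{E_B})(ρ_{E_AE_B})` on `B ⊗ E_B`. -/
def assistedOut (N : QChannel A B) (E : QChannel EA A)
    (ρ : Matrix (EA × EB) (EA × EB) ℂ) : Matrix (B × EB) (B × EB) ℂ :=
  rTensor EB (N.map ∘ₗ E.map) ρ

/-- The classical-quantum state
`ω_{XBE_B} = Σ_x p(x) |x⟩⟨x|_X ⊗ (N∘E^x ⊗ id_{E_B})(ρ_{E_AE_B})`. -/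
def assistedCQ (N : QChannel A B) (ρ : Matrix (EA × EB) (EA × EB) ℂ)
    {n : ℕ} (p : Fin n → ℝ) (E : Fin n → QChannel EA A) :
    Matrix (Fin n × (B × EB)) (Fin n × (B × EB)) ℂ :=
  cqState p fun x => assistedOut N (E x) ρ

/-- Marginal of a state on `X ⊗ (B ⊗ E_B)` obtained by tracing out `B`. -/
def margXE {X : Type*} (ω : Matrix (X × (B × EB)) (X × (B × EB)) ℂ) :
    Matrix (X × EB) (X × EB) ℂ :=
  Matrix.of fun p q => ∑ b, ω (p.1, (b, p.2)) (q.1, (b, q.2))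

/-- `I(XE_B:B)` of a state on `X ⊗ (B ⊗ E_B)` (entropy form). -/
def infoXE_B {X : Type*} [Fintype X] [DecidableEq X]
    (ω : Matrix (X × (B × EB)) (X × (B × EB)) ℂ) : ℝ :=
  entropy (margXE ω) + entropy (ptrR (ptrL ω)) - entropy ω

/-- Regrouping `(X × E_B) × B ≃ X × (B × E_B)`. -/
def regroupEquiv (X B EB : Type*) : (X × EB) × B ≃ X × (B × EB) :=
  (Equiv.prodAssoc X EB B).trans (Equiv.prodCongr (Equiv.refl X) (Equiv.prodComm EB B))

/-- `I(XE_B:B)` of a state on `X ⊗ (B ⊗ E_B)` (relative-entropy form). -/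
def infoXE_B_D {X : Type*} [Fintype X] [DecidableEq X]
    (ω : Matrix (X × (B × EB)) (X × (B × EB)) ℂ) : ℝ :=
  mutualInfoD (ω.submatrix (regroupEquiv X B EB) (regroupEquiv X B EB))

/-- The `ρ`-assisted Holevo information `χ_ρ(N)` (entropy form of `I`). -/
def assistedHolevoS (N : QChannel A B) (ρ : Matrix (EA × EB) (EA × EB) ℂ) : ℝ :=
  sSup { r | ∃ (n : ℕ) (p : Fin n → ℝ) (E : Fin n → QChannel EA A),
    IsProbDist p ∧ r = mutualInfoS (assistedCQ N ρ p E) }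

/-- The `ρ`-assisted Holevo information `χ_ρ(N)` (relative-entropy form of `I`). -/
def assistedHolevoD (N : QChannel A B) (ρ : Matrix (EA × EB) (EA × EB) ℂ) : ℝ :=
  sSup { r | ∃ (n : ℕ) (p : Fin n → ℝ) (E : Fin n → QChannel EA A),
    IsProbDist p ∧ r = mutualInfoD (assistedCQ N ρ p E) }

/-- The `ρ`-assisted mutual information `I_ρ(N)` (entropy form of `I`). -/
def assistedMutualS (N : QChannel A B) (ρ : Matrix (EA × EB) (EA × EB) ℂ) : ℝ :=
  sSup { r | ∃ (n : ℕ) (p : Fin n → ℝ) (E : Fin n → QChannel EA A),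
    IsProbDist p ∧ r = infoXE_B (assistedCQ N ρ p E) }

/-- The `ρ`-assisted mutual information `I_ρ(N)` (relative-entropy form of `I`). -/
def assistedMutualD (N : QChannel A B) (ρ : Matrix (EA × EB) (EA × EB) ℂ) : ℝ :=
  sSup { r | ∃ (n : ℕ) (p : Fin n → ℝ) (E : Fin n → QChannel EA A),
    IsProbDist p ∧ r = infoXE_B_D (assistedCQ N ρ p E) }

/-- The (unassisted) Holevo information `χ(N)` (entropy form of `I`). -/
def holevoS (N : QChannel A B) : ℝ :=
  sSup { r | ∃ (n : ℕ) (p : Fin n → ℝ) (σ : Fin n → Matrix A A ℂ),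
    IsProbDist p ∧ (∀ x, IsState (σ x)) ∧
    r = mutualInfoS (cqState p fun x => N.map (σ x)) }

/-- The (unassisted) Holevo information `χ(N)` (relative-entropy form of `I`). -/
def holevoD (N : QChannel A B) : ℝ :=
  sSup { r | ∃ (n : ℕ) (p : Fin n → ℝ) (σ : Fin n → Matrix A A ℂ),
    IsProbDist p ∧ (∀ x, IsState (σ x)) ∧
    r = mutualInfoD (cqState p fun x => N.map (σ x)) }

end Assisted

section ChannelMI

variable {A B : Type*} [Fintype A] [DecidableEq A] [Fintype B] [DecidableEq B]

/-- `φ_{AA'}` is a purification of `ρ_A`: a pure state whose marginal on the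
first factor is `ρ_A`. -/
def IsPurification {A' : Type*} [Fintype A']
    (φ : Matrix (A × A') (A × A') ℂ) (ρ : Matrix A A ℂ) : Prop :=
  IsState φ ∧ IsPure φ ∧ ptrR φ = ρ

/-- The mutual information of the channel `N`,
`I(N) = max_{ρ_A} I(A':B)_{(N ⊗ id)(φ_{AA'})}` (purifying system `A' ≅ A`). -/
def channelMI (N : QChannel A B) : ℝ :=
  sSup { r | ∃ (ρA : Matrix A A ℂ) (φ : Matrix (A × A) (A × A) ℂ),
    IsState ρA ∧ IsPurification φ ρA ∧ r = mutualInfoS (rTensor A N.map φ) }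

end ChannelMI

section Coding

variable {EA EB A B : Type*} [Fintype EA] [DecidableEq EA] [Fintype EB] [DecidableEq EB]
  [Fintype A] [DecidableEq A] [Fintype B] [DecidableEq B]

/-- Product of `n` states on `B ⊗ E_B`, arranged on `B^n ⊗ E_B^n`. -/
def prodState {n : ℕ} (τ : Fin n → Matrix (B × EB) (B × EB) ℂ) :
    Matrix ((Fin n → B) × (Fin n → EB)) ((Fin n → B) × (Fin n → EB)) ℂ :=
  Matrix.of fun p q => ∏ i, τ i (p.1 i, p.2 i) (q.1 i, q.2 i)

/-- Product of `n` states on `B ⊗ E_B`, with the `B^n` systems permuted by `π`. -/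
def permProdState {n : ℕ} (π : Equiv.Perm (Fin n))
    (τ : Fin n → Matrix (B × EB) (B × EB) ℂ) :
    Matrix ((Fin n → B) × (Fin n → EB)) ((Fin n → B) × (Fin n → EB)) ℂ :=
  Matrix.of fun p q => ∏ i, τ i (p.1 (π i), p.2 i) (q.1 (π i), q.2 i)

/-- Average decoding error probability of a code with message-dependent output
states `ω^m` and decoding POVM `{Λ_m}`. -/
def avgErr {n M : ℕ}
    (ω : Fin M → Matrix ((Fin n → B) × (Fin n → EB)) ((Fin n → B) × (Fin n → EB)) ℂ)
    (Λ : Fin M → Matrix ((Fin n → B) × (Fin n → EB)) ((Fin n → B) × (Fin n → EB)) ℂ) : ℝ :=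
  (1 / (M : ℝ)) * ∑ m, ((1 - Λ m) * ω m).trace.re

/-- Existence of a blocklength-`n`, `M`-message, error-`≤ ε` code with product
encodings for the state-channel pair `(ρ, N)`. -/
def ProdCode (N : QChannel A B) (ρ : Matrix (EA × EB) (EA × EB) ℂ)
    (n M : ℕ) (ε : ℝ) : Prop :=
  ∃ (Enc : Fin M → Fin n → QChannel EA A)
    (Λ : Fin M → Matrix ((Fin n → B) × (Fin n → EB)) ((Fin n → B) × (Fin n → EB)) ℂ),
    (∀ m, (Λ m).PosSemidef) ∧ (∑ m, Λ m) = 1 ∧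
    avgErr (fun m => prodState fun i => assistedOut N (Enc m i) ρ) Λ ≤ ε

/-- Existence of a blocklength-`n`, `M`-message, error-`≤ ε` code with
semi-global encodings (local encodings followed by a global permutation). -/
def SemiGlobalCode (N : QChannel A B) (ρ : Matrix (EA × EB) (EA × EB) ℂ)
    (n M : ℕ) (ε : ℝ) : Prop :=
  ∃ (Enc : Fin M → Fin n → QChannel EA A) (perm : Fin M → Equiv.Perm (Fin n))
    (Λ : Fin M → Matrix ((Fin n → B) × (Fin n → EB)) ((Fin n → B) × (Fin n → EB)) ℂ),
    (∀ m, (Λ m).PosSemidef) ∧ (∑ m, Λ m) = 1 ∧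
    avgErr (fun m => permProdState (perm m) fun i => assistedOut N (Enc m i) ρ) Λ ≤ ε

/-- `R` is an `ε`-achievable rate with product encodings. -/
def ProdAchievable (N : QChannel A B) (ρ : Matrix (EA × EB) (EA × EB) ℂ)
    (ε R : ℝ) : Prop :=
  ∀ δ : ℝ, 0 < δ → ∃ n₀ : ℕ, ∀ n ≥ n₀, ∃ M : ℕ,
    R - δ ≤ Real.logb 2 M / n ∧ ProdCode N ρ n M ε

/-- `R` is an `ε`-achievable rate with semi-global encodings. -/
def SemiGlobalAchievable (N : QChannel A B) (ρ : Matrix (EA × EB) (EA × EB) ℂ)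
    (ε R : ℝ) : Prop :=
  ∀ δ : ℝ, 0 < δ → ∃ n₀ : ℕ, ∀ n ≥ n₀, ∃ M : ℕ,
    R - δ ≤ Real.logb 2 M / n ∧ SemiGlobalCode N ρ n M ε

/-- The `ρ`-assisted `ε`-classical capacity with product encodings. -/
def prodCapacity (N : QChannel A B) (ρ : Matrix (EA × EB) (EA × EB) ℂ) (ε : ℝ) : ℝ :=
  sSup { R | ProdAchievable N ρ ε R }

/-- The `ρ`-assisted `ε`-classical capacity with semi-global encodings. -/
def semiGlobalCapacity (N : QChannel A B) (ρ : Matrix (EA × EB) (EA × EB) ℂ) (ε : ℝ) : ℝ :=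
  sSup { R | SemiGlobalAchievable N ρ ε R }

end Coding

/-- The phase (Weyl) unitary `Z^u = Σ_z e^{2πiuz/d}|z⟩⟨z|` on `ℂ^d`. -/
def Zmat (d : ℕ) (u : Fin d) : Matrix (Fin d) (Fin d) ℂ :=
  Matrix.diagonal fun z => Complex.exp (2 * Real.pi * Complex.I * u.1 * z.1 / d)

/-- Conjugation of a bipartite state by the phase unitary `Z^u ⊗ 1`. -/
def phaseConj {EB : Type*} [Fintype EB] [DecidableEq EB] (d : ℕ) (u : Fin d)
    (φ : Matrix (Fin d × EB) (Fin d × EB) ℂ) : Matrix (Fin d × EB) (Fin d × EB) ℂ :=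
  (Zmat d u ⊗ₖ (1 : Matrix EB EB ℂ)) * φ * (Zmat d u ⊗ₖ (1 : Matrix EB EB ℂ))ᴴ

/-- The (unnormalized) conditional operator `⟨z|φ|z⟩` on `E_B`. -/
def condState {EB : Type*} {d : ℕ} (φ : Matrix (Fin d × EB) (Fin d × EB) ℂ)
    (z : Fin d) : Matrix EB EB ℂ :=
  Matrix.of fun e e' => φ (z, e) (z, e')

/-- Shannon entropy (base 2) of a probability vector. -/
def shannonEnt {ι : Type*} [Fintype ι] (p : ι → ℝ) : ℝ :=
  -∑ i, p i * Real.logb 2 (p i)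

/-- Binary entropy (base 2). -/
def binEnt (p : ℝ) : ℝ :=
  -(p * Real.logb 2 p) - (1 - p) * Real.logb 2 (1 - p)

/-- Kullback-Leibler divergence (base 2) between probability vectors. -/
def klDiv {ι : Type*} [Fintype ι] (p q : ι → ℝ) : ℝ :=
  ∑ i, p i * Real.logb 2 (p i / q i)

section Discord

variable {α β : Type*} [Fintype α] [DecidableEq α] [Fintype β] [DecidableEq β]

/-- The (unnormalized) operator `⟨v|ρ|v⟩` on `α`, sandwiching on the second factor. -/
def sandwichR (ρ : Matrix (α × β) (α × β) ℂ) (v : β → ℂ) : Matrix α α ℂ :=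
  Matrix.of fun a a' => ∑ b, ∑ b', star (v b) * ρ (a, b) (a', b') * v b'

/-- The relative entropy of discord `D_R(ρ_{AB})`. -/
def relEntDiscord (ρ : Matrix (α × β) (α × β) ℂ) : ℝ :=
  sInf { r | ∃ V ∈ Matrix.unitaryGroup β ℂ, r = relEnt ρ
    (∑ y : β, sandwichR ρ (fun b => V b y) ⊗ₖ
      Matrix.vecMulVec (fun b => V b y) (star fun b => V b y)) }

/-- The discord of formation `D_F(ρ_{AB})`. -/
def discordOfFormation (ρ : Matrix (α × β) (α × β) ℂ) : ℝ :=
  sInf { r | ∃ (n : ℕ) (p : Fin n → ℝ) (τ : Fin n → Matrix (α × β) (α × β) ℂ),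
    IsProbDist p ∧ (∀ x, IsState (τ x)) ∧ (ρ = ∑ x, (p x : ℂ) • τ x) ∧
    r = ∑ x, p x * relEntDiscord (τ x) }

end Discord

section Spectral

variable {ι κ : Type*} [Fintype ι] [DecidableEq ι] [Fintype κ] [DecidableEq κ]

/-- The entropy function `η(x) = -x log₂ x`. -/
def eta (x : ℝ) : ℝ := Real.negMulLog x / Real.log 2

@[simp] lemma eta_zero : eta 0 = 0 := by simp [eta]

lemma eta_mul (x y : ℝ) : eta (x * y) = y * eta x + x * eta y := by
  simp only [eta, Real.negMulLog_mul]; ring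

lemma concaveOn_eta : ConcaveOn ℝ (Set.Ici 0) eta := by
  have h := Real.concaveOn_negMulLog.smul (c := (Real.log 2)⁻¹)
    (inv_nonneg.2 (Real.log_nonneg (by norm_num)))
  refine h.congr fun x _ => ?_
  simp [eta, div_eq_inv_mul]

/-- The sum of `η` over the (real parts of the) spectrum of a matrix, with algebraic multiplicity. -/
def specSum (X : Matrix ι ι ℂ) : ℝ := (X.charpoly.roots.map fun x => eta x.re).sum

lemma specSum_eq_sum_eigenvalues {X : Matrix ι ι ℂ} (h : X.IsHermitian) :
    specSum X = ∑ i, eta (h.eigenvalues i) := by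
  simp [specSum, h.roots_charpoly_eq_eigenvalues]

lemma entropy_eq_specSum {X : Matrix ι ι ℂ} (h : X.IsHermitian) : entropy X = specSum X := by
  rw [specSum_eq_sum_eigenvalues h, entropy, matLog, dif_pos h]
  conv_lhs => enter [1, 1, 1, 1]; rw [h.spectral_theorem]
  rw [Unitary.conjStarAlgAut_apply]
  have hU : star (h.eigenvectorUnitary : Matrix ι ι ℂ) * h.eigenvectorUnitary = 1 :=
    Unitary.coe_star_mul_self _
  rw [show ∀ U D E : Matrix ι ι ℂ, U * D * star U * (U * E * star U)
      = U * (D * (star U * U) * E * star U) from fun U D E => by simp only [Matrix.mul_assoc],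
    hU, Matrix.trace_mul_comm, Matrix.mul_assoc _ _ (h.eigenvectorUnitary : Matrix ι ι ℂ), hU,
    Matrix.mul_one, Matrix.mul_one, Matrix.diagonal_mul_diagonal, Matrix.trace_diagonal,
    Complex.re_sum, ← Finset.sum_neg_distrib]
  refine Finset.sum_congr rfl fun i _ => ?_
  rw [Function.comp_apply, RCLike.ofReal_eq_complex_ofReal, ← Complex.ofReal_mul,
    Complex.ofReal_re, Real.logb, eta, Real.negMulLog]
  ring

lemma specSum_diagonal (f : ι → ℂ) : specSum (Matrix.diagonal f) = ∑ i, eta (f i).re := by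
  rw [specSum, Matrix.charpoly_diagonal, Polynomial.roots_prod]
  · simp
  · exact Finset.prod_ne_zero_iff.2 fun i _ => Polynomial.X_sub_C_ne_zero _

lemma specSum_mul_comm (X : Matrix ι κ ℂ) (Y : Matrix κ ι ℂ) :
    specSum (X * Y) = specSum (Y * X) := by
  have h := Matrix.charpoly_mul_comm' X Y
  have h1 := congrArg (fun p : Polynomial ℂ => (p.roots.map fun x => eta x.re).sum) h
  rw [Polynomial.roots_mul (mul_ne_zero (pow_ne_zero _ Polynomial.X_ne_zero)
      (Matrix.charpoly_monic _).ne_zero),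
    Polynomial.roots_mul (mul_ne_zero (pow_ne_zero _ Polynomial.X_ne_zero)
      (Matrix.charpoly_monic _).ne_zero)] at h1
  simpa [specSum, Multiset.map_nsmul, Multiset.sum_nsmul] using h1

lemma specSum_reindex (e : ι ≃ κ) (X : Matrix κ κ ℂ) : specSum (X.submatrix e e) = specSum X := by
  have := Matrix.charpoly_reindex e.symm X
  simp only [Matrix.reindex_apply, Equiv.symm_symm] at this
  rw [specSum, this, specSum]

lemma specSum_zero : specSum (0 : Matrix ι ι ℂ) = 0 := by
  have := specSum_diagonal (fun _ : ι => (0 : ℂ))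
  simpa using this

lemma specSum_blockDiagonal (X : κ → Matrix ι ι ℂ) :
    specSum (Matrix.blockDiagonal X) = ∑ k, specSum (X k) := by
  have h : (Matrix.blockDiagonal X).charpoly = ∏ k, (X k).charpoly := by
    simp_rw [Matrix.charpoly]
    rw [← Matrix.det_blockDiagonal]
    congr 1
    ext ⟨i, k⟩ ⟨j, l⟩ : 1
    by_cases hkl : k = l
    · subst hkl
      simp [Matrix.charmatrix_apply, Matrix.blockDiagonal_apply, Matrix.diagonal_apply]
    · simp [Matrix.blockDiagonal_apply, hkl]
  rw [specSum, h, Polynomial.roots_prod _ _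
    (Finset.prod_ne_zero_iff.2 fun k _ => (Matrix.charpoly_monic _).ne_zero)]
  simp [Multiset.map_bind, Multiset.sum_bind, specSum]

lemma specSum_eq_of_unitary_conj {U : Matrix ι ι ℂ} (hU : star U * U = 1) (X : Matrix ι ι ℂ) :
    specSum (U * X * star U) = specSum X := by
  rw [specSum_mul_comm, ← Matrix.mul_assoc, hU, Matrix.one_mul]

lemma eq_eigenvectorUnitary_conj {X : Matrix ι ι ℂ} (h : X.IsHermitian) :
    X = (h.eigenvectorUnitary : Matrix ι ι ℂ) * Matrix.diagonal (fun i => (h.eigenvalues i : ℂ)) *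
      star (h.eigenvectorUnitary : Matrix ι ι ℂ) := by
  conv_lhs => rw [h.spectral_theorem, Unitary.conjStarAlgAut_apply]
  rfl

lemma trace_re_eq_sum_eigenvalues {X : Matrix ι ι ℂ} (h : X.IsHermitian) :
    X.trace.re = ∑ i, h.eigenvalues i := by
  rw [h.trace_eq_sum_eigenvalues]; simp

lemma specSum_smul {X : Matrix ι ι ℂ} (h : X.IsHermitian) (c : ℝ) :
    specSum ((c : ℂ) • X) = c * specSum X + eta c * X.trace.re := by
  have hU : star (h.eigenvectorUnitary : Matrix ι ι ℂ) * h.eigenvectorUnitary = 1 :=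
    Unitary.coe_star_mul_self _
  have h1 : (c : ℂ) • X = (h.eigenvectorUnitary : Matrix ι ι ℂ) *
      Matrix.diagonal (fun i => ((c * h.eigenvalues i : ℝ) : ℂ)) *
      star (h.eigenvectorUnitary : Matrix ι ι ℂ) := by
    conv_lhs => rw [eq_eigenvectorUnitary_conj h]
    rw [← Matrix.smul_mul, ← Matrix.mul_smul, ← Matrix.diagonal_smul]
    congr 3
    ext i; simp
  rw [h1, specSum_eq_of_unitary_conj hU, specSum_diagonal, specSum_eq_sum_eigenvalues h,
    trace_re_eq_sum_eigenvalues h, Finset.mul_sum, Finset.mul_sum, ← Finset.sum_add_distrib]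
  refine Finset.sum_congr rfl fun i _ => ?_
  rw [Complex.ofReal_re, eta_mul]; ring

/-- The spectral entropy is at most the entropy of the diagonal. -/
lemma specSum_le_sum_eta_diag {X : Matrix ι ι ℂ} (h : X.PosSemidef) :
    specSum X ≤ ∑ i, eta (X i i).re := by
  set U := (h.isHermitian.eigenvectorUnitary : Matrix ι ι ℂ) with hUdef
  have hU : star U * U = 1 := Unitary.coe_star_mul_self _
  have hU' : U * star U = 1 := Unitary.coe_mul_star_self _
  have hrow : ∀ i, ∑ k, ‖U i k‖ ^ 2 = 1 := fun i => by
    have := congrFun (congrFun hU' i) i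
    simp only [Matrix.mul_apply, Matrix.star_apply, Matrix.one_apply_eq, RCLike.star_def,
      Complex.mul_conj', ] at this
    exact_mod_cast this
  have hcol : ∀ k, ∑ i, ‖U i k‖ ^ 2 = 1 := fun k => by
    have := congrFun (congrFun hU k) k
    simp only [Matrix.mul_apply, Matrix.star_apply, Matrix.one_apply_eq, RCLike.star_def,
      Complex.conj_mul'] at this
    exact_mod_cast this
  have hdiag : ∀ i, (X i i).re = ∑ k, ‖U i k‖ ^ 2 • h.isHermitian.eigenvalues k := fun i => by
    have h1 : X i i = ∑ k, ((‖U i k‖ ^ 2 * h.isHermitian.eigenvalues k : ℝ) : ℂ) := by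
      conv_lhs => rw [eq_eigenvectorUnitary_conj h.isHermitian]
      rw [Matrix.mul_apply]
      refine Finset.sum_congr rfl fun k _ => ?_
      rw [Matrix.mul_diagonal, Matrix.star_apply, RCLike.star_def, mul_right_comm,
        ← hUdef, Complex.mul_conj']
      push_cast; rfl
    rw [h1, Complex.re_sum]; simp only [Complex.ofReal_re, smul_eq_mul]
  calc specSum X = ∑ k, (∑ i, ‖U i k‖ ^ 2) * eta (h.isHermitian.eigenvalues k) := by
        simp [hcol, specSum_eq_sum_eigenvalues h.isHermitian]
    _ = ∑ i, ∑ k, ‖U i k‖ ^ 2 • eta (h.isHermitian.eigenvalues k) := by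
        simp_rw [Finset.sum_mul, smul_eq_mul]; exact Finset.sum_comm
    _ ≤ ∑ i, eta (X i i).re := by
        refine Finset.sum_le_sum fun i _ => ?_
        rw [hdiag i]
        exact concaveOn_eta.le_map_sum (fun k _ => by positivity) (hrow i)
          (fun k _ => h.eigenvalues_nonneg k)

/-- Subadditivity of the (unnormalized) entropy under sums of positive matrices. -/
lemma specSum_sum_le {X : κ → Matrix ι ι ℂ} (h : ∀ k, (X k).PosSemidef) :
    specSum (∑ k, X k) ≤ ∑ k, specSum (X k) := by
  let W : Matrix ι (κ × ι) ℂ := Matrix.of fun i p =>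
    ((h p.1).isHermitian.eigenvectorUnitary : Matrix ι ι ℂ) i p.2 *
      (Real.sqrt ((h p.1).isHermitian.eigenvalues p.2) : ℂ)
  have hsq : ∀ k j, ((Real.sqrt ((h k).isHermitian.eigenvalues j) : ℂ)) *
      (Real.sqrt ((h k).isHermitian.eigenvalues j) : ℂ) = ((h k).isHermitian.eigenvalues j : ℂ) := fun k j => by
    rw [← Complex.ofReal_mul, Real.mul_self_sqrt ((h k).eigenvalues_nonneg j)]
  have hW : ∑ k, X k = W * Wᴴ := by
    ext i j
    rw [Matrix.sum_apply, Matrix.mul_apply, Fintype.sum_prod_type]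
    refine Finset.sum_congr rfl fun k _ => ?_
    conv_lhs => rw [eq_eigenvectorUnitary_conj (h k).1]
    rw [Matrix.mul_apply]
    refine Finset.sum_congr rfl fun l _ => ?_
    simp only [W, Matrix.mul_diagonal, Matrix.star_apply, Matrix.conjTranspose_apply,
      Matrix.of_apply, star_mul', ← hsq, RCLike.star_def, Complex.conj_ofReal]
    ring
  have hdiag : ∀ p : κ × ι, ((Wᴴ * W) p p) = ((h p.1).isHermitian.eigenvalues p.2 : ℂ) := fun ⟨k, j⟩ => by
    have hU := congrFun (congrFun
      (Unitary.coe_star_mul_self (h k).isHermitian.eigenvectorUnitary) j) j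
    simp only [Matrix.mul_apply, Matrix.star_apply, Matrix.one_apply_eq] at hU
    rw [Matrix.mul_apply]
    calc _ = (∑ x, star (((h k).isHermitian.eigenvectorUnitary : Matrix ι ι ℂ) x j) *
          ((h k).isHermitian.eigenvectorUnitary : Matrix ι ι ℂ) x j) * ((h k).isHermitian.eigenvalues j : ℂ) := by
          rw [Finset.sum_mul]
          refine Finset.sum_congr rfl fun x _ => ?_
          simp only [W, Matrix.conjTranspose_apply,
            Matrix.of_apply, star_mul', ← hsq, RCLike.star_def, Complex.conj_ofReal]
          ring
      _ = _ := by rw [hU, one_mul]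
  rw [hW, specSum_mul_comm]
  refine (specSum_le_sum_eta_diag (Matrix.posSemidef_conjTranspose_mul_self W)).trans_eq ?_
  simp_rw [hdiag, Complex.ofReal_re, Fintype.sum_prod_type, specSum_eq_sum_eigenvalues (h _).isHermitian]

omit [DecidableEq κ] in
lemma sum_eta_le_logb_card [Nonempty κ] {p : κ → ℝ} (hp : ∀ k, 0 ≤ p k) (hs : ∑ k, p k = 1) :
    ∑ k, eta (p k) ≤ Real.logb 2 (Fintype.card κ) := by
  have hc : (0 : ℝ) < Fintype.card κ := by exact_mod_cast Fintype.card_pos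
  have h := concaveOn_eta.le_map_sum (t := Finset.univ) (w := fun _ : κ => (Fintype.card κ : ℝ)⁻¹)
    (p := p) (fun _ _ => by positivity) (by simp [hc.ne']) (fun k _ => hp k)
  simp only [smul_eq_mul, ← Finset.mul_sum, hs, mul_one] at h
  rw [inv_mul_le_iff₀ hc] at h
  refine h.trans_eq ?_
  simp only [eta, Real.negMulLog, Real.logb, Real.log_inv]
  field_simp

end Spectral

section TensorPower

variable {ι κ μ : Type*} [Fintype ι] [DecidableEq ι] [Fintype κ] [DecidableEq κ]
  [Fintype μ] {n : ℕ}

/-- The tensor product of `n` matrices, indexed by tuples. -/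
def piMat {ι κ : Type*} {n : ℕ} (X : Fin n → Matrix ι κ ℂ) :
    Matrix (Fin n → ι) (Fin n → κ) ℂ :=
  Matrix.of fun p q => ∏ i, X i (p i) (q i)

omit [Fintype ι] [DecidableEq ι] [DecidableEq κ] [Fintype μ] in
lemma piMat_mul (X : Fin n → Matrix ι κ ℂ) (Y : Fin n → Matrix κ μ ℂ) :
    piMat X * piMat Y = piMat fun i => X i * Y i := by
  ext p q
  simp only [piMat, Matrix.mul_apply, Matrix.of_apply, Fintype.prod_sum, Finset.prod_mul_distrib]

omit [Fintype ι] [DecidableEq ι] [Fintype κ] [DecidableEq κ] in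
lemma piMat_conjTranspose (X : Fin n → Matrix ι κ ℂ) :
    (piMat X)ᴴ = piMat fun i => (X i)ᴴ := by
  ext p q
  simp [piMat, Matrix.conjTranspose_apply]

omit [Fintype ι] in
lemma piMat_diagonal (x : Fin n → ι → ℂ) :
    piMat (fun i => Matrix.diagonal (x i)) = Matrix.diagonal fun f => ∏ i, x i (f i) := by
  ext p q
  by_cases h : p = q
  · subst h; simp [piMat]
  · obtain ⟨i, hi⟩ := Function.ne_iff.1 h
    simp only [piMat, Matrix.of_apply, Matrix.diagonal_apply_ne _ h]
    exact Finset.prod_eq_zero (Finset.mem_univ i) (Matrix.diagonal_apply_ne _ hi)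

omit [DecidableEq ι] in
lemma trace_piMat (X : Fin n → Matrix ι ι ℂ) : (piMat X).trace = ∏ i, (X i).trace := by
  simp only [Matrix.trace, Matrix.diag, piMat, Matrix.of_apply, Fintype.prod_sum]

open scoped MatrixOrder Matrix.Norms.L2Operator in
lemma piMat_posSemidef {X : Fin n → Matrix ι ι ℂ} (h : ∀ i, (X i).PosSemidef) :
    (piMat X).PosSemidef := by
  choose Y hY using fun i => 
    CStarAlgebra.nonneg_iff_eq_star_mul_self.1 (h i).nonneg
  have : piMat X = (piMat Y)ᴴ * piMat Y := by
    rw [piMat_conjTranspose, piMat_mul]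
    exact congrArg piMat (funext hY)
  rw [this]
  exact Matrix.posSemidef_conjTranspose_mul_self _

omit [Fintype ι] [DecidableEq ι] in
lemma piMat_isHermitian {X : Fin n → Matrix ι ι ℂ} (h : ∀ i, (X i).IsHermitian) :
    (piMat X).IsHermitian := by
  rw [Matrix.IsHermitian, piMat_conjTranspose]
  exact congrArg piMat (funext h)

omit [DecidableEq ι] in
lemma sum_eta_prod (x : Fin n → ι → ℝ) (h : ∀ i, ∑ k, x i k = 1) :
    ∑ f : Fin n → ι, eta (∏ i, x i (f i)) = ∑ i, ∑ k, eta (x i k) := by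
  induction n with
  | zero => simp [eta]
  | succ n ih =>
    rw [← (Fin.consEquiv fun _ => ι).sum_comp, Fintype.sum_prod_type, Fin.sum_univ_succ,
      ← ih (fun i => x i.succ) fun i => h i.succ]
    have h1 : ∑ f : Fin n → ι, ∏ i, x (Fin.succ i) (f i) = 1 := by
      rw [← Fintype.prod_sum]; exact Finset.prod_eq_one fun i _ => h i.succ
    simp only [Fin.consEquiv_apply, Fin.prod_univ_succ, Fin.cons_zero, Fin.cons_succ, eta_mul,
      Finset.sum_add_distrib, ← Finset.sum_mul, ← Finset.mul_sum, h1, h 0, one_mul]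

lemma specSum_piMat {X : Fin n → Matrix ι ι ℂ} (h : ∀ i, (X i).IsHermitian)
    (ht : ∀ i, (X i).trace = 1) : specSum (piMat X) = ∑ i, specSum (X i) := by
  have hU : star (piMat fun i => ((h i).eigenvectorUnitary : Matrix ι ι ℂ)) *
      piMat (fun i => ((h i).eigenvectorUnitary : Matrix ι ι ℂ)) = 1 := by
    rw [Matrix.star_eq_conjTranspose, piMat_conjTranspose, piMat_mul]
    simp_rw [← Matrix.star_eq_conjTranspose, Unitary.coe_star_mul_self, ← Matrix.diagonal_one]
    rw [piMat_diagonal]; simp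
  have hX : piMat X = piMat (fun i => ((h i).eigenvectorUnitary : Matrix ι ι ℂ)) *
      Matrix.diagonal (fun f => ((∏ i, (h i).eigenvalues (f i) : ℝ) : ℂ)) *
      star (piMat fun i => ((h i).eigenvectorUnitary : Matrix ι ι ℂ)) := by
    push_cast
    rw [Matrix.star_eq_conjTranspose, piMat_conjTranspose,
      ← piMat_diagonal (fun i k => ((h i).eigenvalues k : ℂ)), piMat_mul, piMat_mul]
    exact congrArg piMat (funext fun i => eq_eigenvectorUnitary_conj (h i))
  rw [hX, specSum_eq_of_unitary_conj hU, specSum_diagonal]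
  simp only [Complex.ofReal_re]
  rw [sum_eta_prod]
  · exact Finset.sum_congr rfl fun i _ => (specSum_eq_sum_eigenvalues (h i)).symm
  · intro i
    rw [← trace_re_eq_sum_eigenvalues, ht i, Complex.one_re]

end TensorPower

section Gram

variable {E A B : Type*} [Fintype E] [DecidableEq E] [Fintype A] [DecidableEq A]
  [Fintype B] [DecidableEq B]

omit [Fintype E] [DecidableEq E] [DecidableEq A] in
lemma one_kronecker_conj_apply (V : Matrix E A ℂ) (J : Matrix (B × A) (B × A) ℂ) (b b' : B)
    (e e' : E) :
    (((1 : Matrix B B ℂ) ⊗ₖ V) * J * ((1 : Matrix B B ℂ) ⊗ₖ V)ᴴ) (b, e) (b', e') =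
      ∑ a, ∑ a', V e a * J (b, a) (b', a') * star (V e' a') := by
  simp only [Matrix.mul_apply, Fintype.sum_prod_type, Matrix.conjTranspose_apply,
    Matrix.kroneckerMap_apply, Matrix.one_apply, ite_mul, one_mul, zero_mul,
    apply_ite (star : ℂ → ℂ), star_zero, mul_ite, mul_zero, Finset.sum_ite_irrel,
    Finset.sum_const_zero, Finset.sum_ite_eq, Finset.mem_univ, if_true, Finset.sum_mul]
  exact Finset.sum_comm

/-- Conjugating the second tensor factor by `V` only affects the spectrum through `Vᴴ * V`. -/
lemma specSum_one_kronecker_conj (V : Matrix E A ℂ) (J : Matrix (B × A) (B × A) ℂ) :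
    specSum (((1 : Matrix B B ℂ) ⊗ₖ V) * J * ((1 : Matrix B B ℂ) ⊗ₖ V)ᴴ) =
      specSum (J * ((1 : Matrix B B ℂ) ⊗ₖ (Vᴴ * V))) := by
  rw [specSum_mul_comm, ← Matrix.mul_assoc, specSum_mul_comm, Matrix.conjTranspose_kronecker,
    ← Matrix.mul_kronecker_mul, Matrix.conjTranspose_one, Matrix.one_mul]

end Gram

section ClassicalQuantum

variable {ι γ : Type*} [Fintype ι] [DecidableEq ι] [Fintype γ] [DecidableEq γ]

/-- The Holevo formula for the mutual information of a classical-quantum state. -/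
lemma mutualInfoS_cqState {p : ι → ℝ} {σ : ι → Matrix γ γ ℂ} (hσ : ∀ x, (σ x).IsHermitian)
    (ht : ∀ x, (σ x).trace = 1) :
    mutualInfoS (cqState p σ) = specSum (∑ x, (p x : ℂ) • σ x) - ∑ x, p x * specSum (σ x) := by
  have hH : ∀ x, ((p x : ℂ) • σ x).IsHermitian := fun x => by
    rw [Matrix.IsHermitian, Matrix.conjTranspose_smul, hσ x, RCLike.star_def, Complex.conj_ofReal]
  have hblock : cqState p σ = (Matrix.blockDiagonal fun x => (p x : ℂ) • σ x).submatrix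
      (Equiv.prodComm ι γ) (Equiv.prodComm ι γ) := by
    ext ⟨x, a⟩ ⟨y, b⟩
    simp [cqState, Matrix.blockDiagonal_apply]
  have hR : ptrR (cqState p σ) = Matrix.diagonal fun x => (p x : ℂ) := by
    ext x y
    by_cases h : x = y
    · subst h
      simp only [ptrR, cqState, Matrix.of_apply, if_true, ← Finset.mul_sum,
        Matrix.diagonal_apply_eq]
      rw [show ∑ b, σ x b b = 1 from ht x, mul_one]
    · simp [ptrR, cqState, h]
  have hL : ptrL (cqState p σ) = ∑ x, (p x : ℂ) • σ x := by
    ext a b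
    simp [ptrL, cqState, Matrix.sum_apply]
  have hHerm : (cqState p σ).IsHermitian := by
    rw [hblock]
    refine Matrix.IsHermitian.submatrix ?_ _
    rw [Matrix.IsHermitian, Matrix.blockDiagonal_conjTranspose]
    exact congrArg Matrix.blockDiagonal (funext hH)
  rw [mutualInfoS, hR, hL, entropy_eq_specSum, entropy_eq_specSum, entropy_eq_specSum hHerm, hblock,
    specSum_reindex, specSum_blockDiagonal, specSum_diagonal]
  · simp only [specSum_smul (hσ _), ht, Complex.one_re, mul_one, Complex.ofReal_re,
      Finset.sum_add_distrib]
    ring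
  · rw [Matrix.IsHermitian, Matrix.conjTranspose_sum]
    exact Finset.sum_congr rfl fun x _ => hH x
  · refine Matrix.isHermitian_diagonal_of_self_adjoint _ ?_
    ext x; simp

end ClassicalQuantum

section Symmetrize

variable {B κ : Type*} [Fintype B] [DecidableEq B] [Fintype κ] [DecidableEq κ] {n : ℕ}

/-- The average of `X (z 0) ⊗ … ⊗ X (z (n - 1))` over all permutations of the tensor factors. -/
def symAvg (X : κ → Matrix B B ℂ) (z : Fin n → κ) : Matrix (Fin n → B) (Fin n → B) ℂ :=
  ((n.factorial : ℝ)⁻¹ : ℂ) • ∑ π : Equiv.Perm (Fin n),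
    (piMat fun i => X (z i)).submatrix (fun p => p ∘ π) (fun p => p ∘ π)

omit [Fintype κ] [DecidableEq κ] in
lemma symAvg_posSemidef {X : κ → Matrix B B ℂ} (h : ∀ a, (X a).PosSemidef) (z : Fin n → κ) :
    (symAvg X z).PosSemidef := by
  refine Matrix.PosSemidef.smul (Matrix.posSemidef_sum _ fun π _ =>
    (piMat_posSemidef fun i => h (z i)).submatrix _) ?_
  rw [← Complex.ofReal_inv]
  exact Complex.zero_le_real.2 (by positivity)

omit [Fintype κ] [DecidableEq κ] [DecidableEq B] in
lemma trace_symAvg {X : κ → Matrix B B ℂ} (h : ∀ a, (X a).trace = 1) (z : Fin n → κ) :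
    (symAvg X z).trace = 1 := by
  have h1 : ∀ π : Equiv.Perm (Fin n),
      ((piMat fun i => X (z i)).submatrix (fun p => p ∘ π) (fun p => p ∘ π)).trace = 1 := by
    intro π
    have h2 := trace_piMat fun i => X (z i)
    simp only [h, Finset.prod_const_one] at h2
    rw [← h2]
    exact (Equiv.arrowCongr π.symm (Equiv.refl B)).sum_comp
      fun p => (piMat fun i => X (z i)) p p
  have h0 : (n.factorial : ℂ) ≠ 0 := by exact_mod_cast n.factorial_ne_zero
  simp [symAvg, Matrix.trace_smul, Matrix.trace_sum, h1, Fintype.card_perm, h0]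

omit [Fintype B] [DecidableEq B] [Fintype κ] [DecidableEq κ] in
lemma symAvg_comp_perm (X : κ → Matrix B B ℂ) (z : Fin n → κ) (τ : Equiv.Perm (Fin n)) :
    symAvg X (z ∘ τ) = symAvg X z := by
  rw [symAvg, symAvg, ← Equiv.sum_comp (Equiv.mulRight τ)]
  congr 1
  refine Finset.sum_congr rfl fun π _ => ?_
  ext p q
  simp only [piMat, Matrix.submatrix_apply, Matrix.of_apply, Function.comp_apply,
    Equiv.coe_mulRight, Equiv.Perm.coe_mul]
  exact Equiv.prod_comp τ fun i => X (z i) (p (π i)) (q (π i))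

/-- The type (vector of letter multiplicities) of a tuple. -/
def tupleType (z : Fin n → κ) (a : κ) : Fin (n + 1) :=
  ⟨Fintype.card {i // z i = a}, Nat.lt_succ_of_le <| by
    simpa using Fintype.card_subtype_le fun i => z i = a⟩

omit [Fintype B] [DecidableEq B] [Fintype κ] in
lemma symAvg_eq_of_tupleType_eq (X : κ → Matrix B B ℂ) {z w : Fin n → κ}
    (h : tupleType z = tupleType w) : symAvg X z = symAvg X w := by
  have e : ∀ a, {i // z i = a} ≃ {i // w i = a} := fun a =>
    Fintype.equivOfCardEq (congrArg Fin.val (congrFun h a))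
  have : z = w ∘ Equiv.ofFiberEquiv e := funext fun i => (Equiv.ofFiberEquiv_map e i).symm
  rw [this, symAvg_comp_perm]

omit [DecidableEq B] [Fintype B] [DecidableEq κ] in
lemma sum_smul_symAvg (X : κ → Matrix B B ℂ) (lam : κ → ℝ) :
    ∑ z : Fin n → κ, ((∏ i, lam (z i) : ℝ) : ℂ) • symAvg X z =
      piMat fun _ : Fin n => ∑ a, (lam a : ℂ) • X a := by
  ext p q
  have h0 : (n.factorial : ℂ) ≠ 0 := by exact_mod_cast n.factorial_ne_zero
  have h1 : ∀ π : Equiv.Perm (Fin n),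
      ∑ z : Fin n → κ, (∏ i, (lam (z i) : ℂ)) * ∏ i, X (z i) (p (π i)) (q (π i)) =
        (piMat fun _ : Fin n => ∑ a, (lam a : ℂ) • X a) p q := by
    intro π
    simp only [piMat, Matrix.of_apply, Matrix.sum_apply, Matrix.smul_apply, smul_eq_mul]
    rw [← Equiv.prod_comp π, Fintype.prod_sum]
    exact Finset.sum_congr rfl fun z _ => Finset.prod_mul_distrib.symm
  calc _ = ∑ z : Fin n → κ, (n.factorial : ℂ)⁻¹ * ∑ π : Equiv.Perm (Fin n),
        (∏ i, (lam (z i) : ℂ)) * ∏ i, X (z i) (p (π i)) (q (π i)) := by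
        simp only [Matrix.sum_apply, Matrix.smul_apply, symAvg, smul_eq_mul,
          Matrix.submatrix_apply, piMat, Matrix.of_apply, Function.comp_apply, Finset.mul_sum]
        refine Finset.sum_congr rfl fun z _ => Finset.sum_congr rfl fun π _ => ?_
        push_cast; ring
    _ = _ := by
        rw [← Finset.mul_sum, Finset.sum_comm]
        simp only [h1, Finset.sum_const, Finset.card_univ, Fintype.card_perm, Fintype.card_fin,
          nsmul_eq_mul]
        rw [inv_mul_cancel_left₀ h0]

/-- Symmetrizing a product ensemble costs at most the entropy of the type. -/
lemma specSum_piMat_le_symAvg {X : κ → Matrix B B ℂ} (hX : ∀ a, (X a).PosSemidef)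
    (ht : ∀ a, (X a).trace = 1) {lam : κ → ℝ} (hl : ∀ a, 0 ≤ lam a) (hs : ∑ a, lam a = 1) :
    specSum (piMat fun _ : Fin n => ∑ a, (lam a : ℂ) • X a) ≤
      ∑ z : Fin n → κ, (∏ i, lam (z i)) * specSum (symAvg X z) +
        Fintype.card κ * Real.logb 2 (n + 1) := by
  set P : (Fin n → κ) → ℝ := fun z => ∏ i, lam (z i)
  have hP : ∀ z, 0 ≤ P z := fun z => Finset.prod_nonneg fun i _ => hl _
  have hPs : ∑ z, P z = 1 := by
    rw [← Fintype.prod_sum]; simp [hs]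
  let p : (κ → Fin (n + 1)) → ℝ := fun t => ∑ z with tupleType z = t, P z
  let Y : (κ → Fin (n + 1)) → Matrix (Fin n → B) (Fin n → B) ℂ :=
    fun t => ∑ z with tupleType z = t, (P z : ℂ) • symAvg X z
  have hY : ∀ t, (Y t).PosSemidef := fun t => Matrix.posSemidef_sum _ fun z _ =>
    (symAvg_posSemidef hX z).smul (Complex.zero_le_real.2 (hP z))
  have hYs : ∀ t, specSum (Y t) =
      (∑ z with tupleType z = t, P z * specSum (symAvg X z)) + eta (p t) := by
    intro t
    by_cases hne : ∃ w : Fin n → κ, tupleType w = t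
    · obtain ⟨w, hw⟩ := hne
      have hz : ∀ z ∈ Finset.univ.filter (fun z : Fin n → κ => tupleType z = t),
          symAvg X z = symAvg X w := fun z hz =>
        symAvg_eq_of_tupleType_eq X ((Finset.mem_filter.1 hz).2.trans hw.symm)
      have h1 : Y t = (p t : ℂ) • symAvg X w := by
        simp only [Y, p]
        push_cast
        rw [Finset.sum_smul]
        exact Finset.sum_congr rfl fun z h => by rw [hz z h]
      have h2 : ∑ z with tupleType z = t, P z * specSum (symAvg X z) =
          p t * specSum (symAvg X w) := by
        rw [Finset.sum_mul]
        exact Finset.sum_congr rfl fun z h => by rw [hz z h]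
      have h3 := specSum_smul (symAvg_posSemidef hX w).isHermitian (p t)
      rw [trace_symAvg ht, Complex.one_re, mul_one] at h3
      rw [h1, h2, h3]
    · have hf : Finset.univ.filter (fun z : Fin n → κ => tupleType z = t) = ∅ :=
        Finset.filter_eq_empty_iff.2 fun z _ h => hne ⟨z, h⟩
      simp only [Y, p, hf, Finset.sum_empty, specSum_zero, eta_zero, add_zero]
  have hsum : ∑ t, Y t = piMat fun _ : Fin n => ∑ a, (lam a : ℂ) • X a := by
    rw [← sum_smul_symAvg]
    exact Finset.sum_fiberwise _ _ _
  rw [← hsum]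
  refine (specSum_sum_le hY).trans ?_
  simp only [hYs, Finset.sum_add_distrib]
  rw [Finset.sum_fiberwise]
  refine add_le_add le_rfl ?_
  refine (sum_eta_le_logb_card (fun t => Finset.sum_nonneg fun z _ => hP z) ?_).trans_eq ?_
  · exact (Finset.sum_fiberwise _ _ _).trans hPs
  · simp [Real.logb_pow]

end Symmetrize

section Channel

variable {EB B : Type*} [Fintype EB] [DecidableEq EB] [Fintype B] [DecidableEq B] {d : ℕ}

/-- The Choi matrix of a channel. -/
def choi (M : QChannel (Fin d) B) : Matrix (B × Fin d) (B × Fin d) ℂ :=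
  Matrix.of fun p q => M.map (Matrix.single p.2 q.2 1) p.1 q.1

lemma choi_posSemidef (M : QChannel (Fin d) B) : (choi M).PosSemidef := by
  let w : Fin d × Fin d → ℂ := fun p => if p.1 = p.2 then 1 else 0
  have h := (M.cp d _ (Matrix.posSemidef_vecMulVec_self_star w)).submatrix
    (Prod.swap : B × Fin d → Fin d × B)
  convert h using 1
  ext ⟨b, a⟩ ⟨b', a'⟩
  simp only [choi, lTensor, Matrix.of_apply, LinearMap.coe_mk, AddHom.coe_mk,
    Matrix.submatrix_apply, Prod.swap_prod_mk]
  refine congrArg (fun Y => M.map Y b b') ?_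
  ext i j
  simp [w, Matrix.vecMulVec_apply, Matrix.single_apply, ite_and]
  split_ifs <;> rfl

lemma map_apply_eq_sum_choi (M : QChannel (Fin d) B) (X : Matrix (Fin d) (Fin d) ℂ) (b b' : B) :
    M.map X b b' = ∑ a, ∑ a', X a a' * choi M (b, a) (b', a') := by
  conv_lhs => rw [Matrix.matrix_eq_sum_single X]
  simp only [map_sum, Matrix.sum_apply, choi, Matrix.of_apply]
  refine Finset.sum_congr rfl fun a _ => Finset.sum_congr rfl fun a' _ => ?_
  rw [show Matrix.single a a' (X a a') = X a a' • Matrix.single a a' (1 : ℂ) by simp, _root_.map_smul]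
  rfl

/-- The output of `M` on a computational basis state. -/
def basisOut (M : QChannel (Fin d) B) (a : Fin d) : Matrix B B ℂ := M.map (Matrix.single a a 1)

lemma basisOut_posSemidef (M : QChannel (Fin d) B) (a : Fin d) : (basisOut M a).PosSemidef :=
  (choi_posSemidef M).submatrix fun b => (b, a)

lemma trace_basisOut (M : QChannel (Fin d) B) (a : Fin d) : (basisOut M a).trace = 1 := by
  rw [basisOut, M.tp]; simp

/-- The phase `e^{2πiuz/d}`. -/
def phase (d : ℕ) (u z : Fin d) : ℂ := Complex.exp (2 * Real.pi * Complex.I * u.1 * z.1 / d)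

lemma phase_mul_star_self (u z : Fin d) : phase d u z * star (phase d u z) = 1 := by
  rw [RCLike.star_def, Complex.mul_conj', phase,
    show 2 * (Real.pi : ℂ) * Complex.I * u.1 * z.1 / d =
      ((2 * Real.pi * u.1 * z.1 / d : ℝ) : ℂ) * Complex.I by push_cast; ring,
    Complex.norm_exp_ofReal_mul_I]
  simp

lemma sum_phase_mul_star (hd : 0 < d) (a a' : Fin d) :
    ∑ u, phase d u a * star (phase d u a') = if a = a' then (d : ℂ) else 0 := by
  by_cases h : a = a'
  · subst h; simp only [phase_mul_star_self]; simp
  rw [if_neg h]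
  have hprim := Complex.isPrimitiveRoot_exp d hd.ne'
  set w := Complex.exp (2 * Real.pi * Complex.I / d) with hw
  have hpow : ∀ u z : Fin d, phase d u z = (w ^ z.1) ^ u.1 := fun u z => by
    rw [hw, ← pow_mul, ← Complex.exp_nat_mul, phase]
    congr 1; push_cast; ring
  have hw0 : w ≠ 0 := Complex.exp_ne_zero _
  have hinv : ∀ u z : Fin d, star (phase d u z) = ((w ^ z.1) ^ u.1)⁻¹ := fun u z =>
    eq_inv_of_mul_eq_one_right (by rw [← hpow]; exact phase_mul_star_self u z)
  set r := w ^ a.1 / w ^ a'.1 with hr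
  have hr1 : r ≠ 1 := fun h1 => h <| Fin.ext <| hprim.pow_inj a.2 a'.2 <|
    (div_eq_one_iff_eq (pow_ne_zero _ hw0)).1 h1
  have hrd : r ^ d = 1 := by
    rw [hr, div_pow, ← pow_mul, ← pow_mul, mul_comm a.1, mul_comm a'.1, pow_mul, pow_mul,
      hprim.pow_eq_one]
    simp
  have hsum : ∑ u : Fin d, phase d u a * star (phase d u a') = ∑ i ∈ Finset.range d, r ^ i := by
    rw [← Fin.sum_univ_eq_sum_range]
    refine Finset.sum_congr rfl fun u _ => ?_
    rw [hinv, hpow, hr, div_pow, div_eq_mul_inv]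
  have hg := mul_geom_sum r d
  rw [hrd, sub_self] at hg
  rw [hsum]
  exact (mul_eq_zero.1 hg).resolve_left (sub_ne_zero.2 hr1)

omit [Fintype EB] [DecidableEq EB] in
lemma rTensor_apply_eq_sum_choi (M : QChannel (Fin d) B)
    (φ : Matrix (Fin d × EB) (Fin d × EB) ℂ) (b b' : B) (e e' : EB) :
    rTensor EB M.map φ (b, e) (b', e') =
      ∑ a, ∑ a', φ (a, e) (a', e') * choi M (b, a) (b', a') := by
  simp only [rTensor, LinearMap.coe_mk, AddHom.coe_mk, Matrix.of_apply, map_apply_eq_sum_choi]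

lemma phaseConj_apply (u : Fin d) (φ : Matrix (Fin d × EB) (Fin d × EB) ℂ) (a a' : Fin d)
    (e e' : EB) :
    phaseConj d u φ (a, e) (a', e') =
      phase d u a * φ (a, e) (a', e') * star (phase d u a') := by
  have h : Zmat d u ⊗ₖ (1 : Matrix EB EB ℂ) = Matrix.diagonal fun p => phase d u p.1 := by
    rw [Zmat, ← Matrix.diagonal_one, Matrix.diagonal_kronecker_diagonal]
    simp only [mul_one, phase]
  rw [phaseConj, h, Matrix.diagonal_conjTranspose, Matrix.mul_diagonal, Matrix.diagonal_mul]
  rfl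

section PureInput

variable (M : QChannel (Fin d) B) {V : Matrix EB (Fin d) ℂ}
  {φ : Matrix (Fin d × EB) (Fin d × EB) ℂ}

/-- The channel output on a phase-shifted pure state, written with the Choi matrix. -/
lemma rTensor_phaseConj_eq
    (hφ : ∀ a a' e e', φ (a, e) (a', e') = V e a * star (V e' a')) (u : Fin d) :
    rTensor EB M.map (phaseConj d u φ) =
      ((1 : Matrix B B ℂ) ⊗ₖ V) *
        (((1 : Matrix B B ℂ) ⊗ₖ Matrix.diagonal (phase d u)) * choi M *
          ((1 : Matrix B B ℂ) ⊗ₖ Matrix.diagonal (phase d u))ᴴ) *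
        ((1 : Matrix B B ℂ) ⊗ₖ V)ᴴ := by
  ext ⟨b, e⟩ ⟨b', e'⟩
  rw [one_kronecker_conj_apply, rTensor_apply_eq_sum_choi]
  refine Finset.sum_congr rfl fun a _ => Finset.sum_congr rfl fun a' _ => ?_
  rw [phaseConj_apply, hφ, one_kronecker_conj_apply, Finset.sum_eq_single a, Finset.sum_eq_single a',
    Matrix.diagonal_apply_eq, Matrix.diagonal_apply_eq]
  · ring
  · intro c _ hc; rw [Matrix.diagonal_apply_ne _ hc.symm, star_zero, mul_zero]
  · simp
  · intro c _ hc; simp [Matrix.diagonal_apply_ne _ hc.symm]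
  · simp

lemma rTensor_phaseConj_isHermitian
    (hφ : ∀ a a' e e', φ (a, e) (a', e') = V e a * star (V e' a')) (u : Fin d) :
    (rTensor EB M.map (phaseConj d u φ)).IsHermitian := by
  rw [rTensor_phaseConj_eq M hφ]
  exact Matrix.isHermitian_mul_mul_conjTranspose _
    (Matrix.isHermitian_mul_mul_conjTranspose _ (choi_posSemidef M).isHermitian)

lemma trace_rTensor_phaseConj (hφ : φ.trace = 1) (u : Fin d) :
    (rTensor EB M.map (phaseConj d u φ)).trace = 1 := by
  have h1 : ∀ e, ∑ b, rTensor EB M.map (phaseConj d u φ) (b, e) (b, e) = ∑ a, φ (a, e) (a, e) := by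
    intro e
    have h := M.tp (Matrix.of fun a a' => phaseConj d u φ (a, e) (a', e))
    simp only [Matrix.trace, Matrix.diag, Matrix.of_apply] at h
    refine Eq.trans h (Finset.sum_congr rfl fun a _ => ?_)
    rw [phaseConj_apply, mul_right_comm, phase_mul_star_self, one_mul]
  rw [← hφ, Matrix.trace, Matrix.trace, Fintype.sum_prod_type_right, Fintype.sum_prod_type_right]
  exact Finset.sum_congr rfl fun e _ => h1 e

/-- If the Schmidt vectors are orthogonal, phase shifts do not change the output spectrum. -/
lemma specSum_rTensor_phaseConj {lam : Fin d → ℝ}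
    (hφ : ∀ a a' e e', φ (a, e) (a', e') = V e a * star (V e' a'))
    (hV : Vᴴ * V = Matrix.diagonal fun z => (lam z : ℂ)) (u : Fin d) :
    specSum (rTensor EB M.map (phaseConj d u φ)) =
      specSum (choi M * ((1 : Matrix B B ℂ) ⊗ₖ (Vᴴ * V))) := by
  rw [rTensor_phaseConj_eq M hφ, specSum_one_kronecker_conj, hV]
  set D := (1 : Matrix B B ℂ) ⊗ₖ Matrix.diagonal (phase d u)
  set Λ := (1 : Matrix B B ℂ) ⊗ₖ Matrix.diagonal fun z => (lam z : ℂ)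
  have hcomm : Dᴴ * Λ = Λ * Dᴴ := by
    simp only [D, Λ, Matrix.conjTranspose_kronecker, Matrix.conjTranspose_one,
      Matrix.diagonal_conjTranspose, ← Matrix.mul_kronecker_mul, Matrix.diagonal_mul_diagonal]
    simp only [mul_comm]
  have hD : star D * D = 1 := by
    simp only [D, Matrix.star_eq_conjTranspose, Matrix.conjTranspose_kronecker,
      Matrix.conjTranspose_one, Matrix.diagonal_conjTranspose, ← Matrix.mul_kronecker_mul,
      Matrix.diagonal_mul_diagonal, Matrix.one_mul]
    rw [← Matrix.one_kronecker_one, ← Matrix.diagonal_one (n := Fin d)]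
    congr 2
    ext z
    rw [mul_comm]
    exact phase_mul_star_self u z
  rw [Matrix.mul_assoc, hcomm, ← Matrix.mul_assoc, Matrix.mul_assoc D]
  exact specSum_eq_of_unitary_conj hD _

lemma average_rTensor_phaseConj (hd : 0 < d)
    (hφ : ∀ a a' e e', φ (a, e) (a', e') = V e a * star (V e' a')) (b b' : B) (e e' : EB) :
    ∑ u, rTensor EB M.map (phaseConj d u φ) (b, e) (b', e') =
      d * ∑ a, V e a * basisOut M a b b' * star (V e' a) := by
  have h : ∀ u, rTensor EB M.map (phaseConj d u φ) (b, e) (b', e') =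
      ∑ a, ∑ a', (phase d u a * star (phase d u a')) *
        (V e a * choi M (b, a) (b', a') * star (V e' a')) := fun u => by
    rw [rTensor_apply_eq_sum_choi]
    refine Finset.sum_congr rfl fun a _ => Finset.sum_congr rfl fun a' _ => ?_
    rw [phaseConj_apply, hφ]; ring
  simp only [h]
  rw [Finset.sum_comm, Finset.mul_sum]
  refine Finset.sum_congr rfl fun a _ => ?_
  rw [Finset.sum_comm]
  simp only [← Finset.sum_mul, sum_phase_mul_star hd, ite_mul, zero_mul, Finset.sum_ite_eq,
    Finset.mem_univ, if_true]
  rfl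

/-- The average output of the permutation and phase randomization. -/
lemma average_permProdState (hd : 0 < d) (n : ℕ)
    (hφ : ∀ a a' e e', φ (a, e) (a', e') = V e a * star (V e' a')) :
    ∑ c : Equiv.Perm (Fin n) × (Fin n → Fin d), ((((n.factorial * d ^ n : ℕ) : ℝ)⁻¹ : ℝ) : ℂ) •
        permProdState c.1 (fun i => rTensor EB M.map (phaseConj d (c.2 i) φ)) =
      ((1 : Matrix (Fin n → B) (Fin n → B) ℂ) ⊗ₖ piMat fun _ : Fin n => V) *
        Matrix.blockDiagonal (fun z : Fin n → Fin d => symAvg (basisOut M) z) *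
        ((1 : Matrix (Fin n → B) (Fin n → B) ℂ) ⊗ₖ piMat fun _ : Fin n => V)ᴴ := by
  ext ⟨p, r⟩ ⟨q, s⟩
  have hd0 : (d : ℂ) ^ n ≠ 0 := pow_ne_zero _ (by exact_mod_cast hd.ne')
  have hπ : ∀ π : Equiv.Perm (Fin n), ∑ c : Fin n → Fin d,
      ∏ i, rTensor EB M.map (phaseConj d (c i) φ) (p (π i), r i) (q (π i), s i) =
      d ^ n * ∑ z : Fin n → Fin d, (∏ i, V (r i) (z i)) *
        (∏ i, basisOut M (z i) (p (π i)) (q (π i))) * ∏ i, star (V (s i) (z i)) := fun π => by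
    rw [← Fintype.prod_sum fun i u =>
      rTensor EB M.map (phaseConj d u φ) (p (π i), r i) (q (π i), s i)]
    simp only [average_rTensor_phaseConj M hd hφ, Finset.prod_mul_distrib, Finset.prod_const,
      Finset.card_univ, Fintype.card_fin, Fintype.prod_sum]
  rw [one_kronecker_conj_apply]
  simp only [Matrix.sum_apply, Matrix.smul_apply, permProdState, Matrix.of_apply, smul_eq_mul,
    Fintype.sum_prod_type, ← Finset.mul_sum, hπ]
  have hR : ∀ z : Fin n → Fin d, ∑ z' : Fin n → Fin d, piMat (fun _ : Fin n => V) r z *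
      Matrix.blockDiagonal (fun z : Fin n → Fin d => symAvg (basisOut M) z) (p, z) (q, z') *
      star (piMat (fun _ : Fin n => V) s z') = (n.factorial : ℂ)⁻¹ * ∑ π : Equiv.Perm (Fin n),
        (∏ i, V (r i) (z i)) *
        (∏ i, basisOut M (z i) (p (π i)) (q (π i))) * ∏ i, star (V (s i) (z i)) := fun z => by
    rw [Finset.sum_eq_single z]
    · simp only [Matrix.blockDiagonal_apply_eq, symAvg, Matrix.smul_apply, Matrix.sum_apply,
        smul_eq_mul, piMat, Matrix.submatrix_apply, Matrix.of_apply, Function.comp_apply,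
        star_prod, ← Finset.mul_sum, ← Finset.sum_mul]
      push_cast; ring
    · intro w _ hw
      rw [Matrix.blockDiagonal_apply_ne _ _ _ hw.symm]; simp
    · simp
  simp only [hR, ← Finset.mul_sum]
  rw [Finset.sum_comm]
  push_cast
  rw [mul_inv, mul_assoc, inv_mul_cancel_left₀ hd0]

omit [DecidableEq EB] in
lemma ptrR_rTensor {lam : Fin d → ℝ} (hspec : ptrR φ = Matrix.diagonal fun z => (lam z : ℂ)) :
    ptrR (rTensor EB M.map φ) = ∑ a, (lam a : ℂ) • basisOut M a := by
  ext b b'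
  have h : ∀ a a', ∑ e, φ (a, e) (a', e) = if a = a' then (lam a : ℂ) else 0 := fun a a' => by
    rw [← Matrix.diagonal_apply (fun z => (lam z : ℂ)), ← hspec]; rfl
  simp only [ptrR, Matrix.of_apply, rTensor_apply_eq_sum_choi]
  rw [Finset.sum_comm, Matrix.sum_apply]
  refine Finset.sum_congr rfl fun a _ => ?_
  rw [Finset.sum_comm]
  simp only [← Finset.sum_mul, h, ite_mul, zero_mul, Finset.sum_ite_eq, Finset.mem_univ, if_true]
  rfl

omit [Fintype EB] [DecidableEq EB] in
lemma ptrL_rTensor (hφ : ∀ a a' e e', φ (a, e) (a', e') = V e a * star (V e' a')) :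
    ptrL (rTensor EB M.map φ) = V * Vᴴ := by
  ext e e'
  have h := M.tp (Matrix.of fun a a' => φ (a, e) (a', e'))
  simp only [Matrix.trace, Matrix.diag, Matrix.of_apply, hφ] at h
  simp only [ptrL, rTensor, LinearMap.coe_mk, AddHom.coe_mk, Matrix.of_apply, Matrix.mul_apply,
    Matrix.conjTranspose_apply, hφ]
  exact h

end PureInput

/-- Regrouping `Bⁿ ⊗ E_Bⁿ` into `(B ⊗ E_B)ⁿ` after permuting the factors of `Bⁿ`. -/
def permRegroup {n : ℕ} (B EB : Type*) (π : Equiv.Perm (Fin n)) :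
    (Fin n → B) × (Fin n → EB) ≃ (Fin n → B × EB) :=
  ((Equiv.arrowCongr π.symm (Equiv.refl B)).prodCongr (Equiv.refl _)).trans
    (Equiv.arrowProdEquivProdArrow (Fin n) (fun _ => B) (fun _ => EB)).symm

omit [Fintype EB] [DecidableEq EB] [Fintype B] [DecidableEq B] in
lemma permProdState_eq_submatrix {n : ℕ} (π : Equiv.Perm (Fin n))
    (τ : Fin n → Matrix (B × EB) (B × EB) ℂ) :
    permProdState π τ = (piMat τ).submatrix (permRegroup B EB π) (permRegroup B EB π) := rfl

omit [DecidableEq EB] [DecidableEq B] in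
lemma trace_permProdState {n : ℕ} (π : Equiv.Perm (Fin n))
    (τ : Fin n → Matrix (B × EB) (B × EB) ℂ) :
    (permProdState π τ).trace = ∏ i, (τ i).trace := by
  rw [← trace_piMat]
  exact (permRegroup B EB π).sum_comp fun p => piMat τ p p

end Channel

/-- randomizing over global permutations and random phases loses
at most `d log(n+1)` bits of correlation:
`n·I(B:E_B)_σ - I(ΠUⁿ : BⁿE_Bⁿ)_ω ≤ d log(n+1)`. -/
theorem permutation_phase_randomization_bound
    {EB B : Type*} [Fintype EB] [DecidableEq EB] [Fintype B] [DecidableEq B]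
    {d : ℕ} (hd : 0 < d)
    (φ : Matrix (Fin d × EB) (Fin d × EB) ℂ) (hφ : IsState φ) (hpure : IsPure φ)
    (lam : Fin d → ℝ)
    (hspec : ptrR φ = Matrix.diagonal fun z => (lam z : ℂ))
    (M : QChannel (Fin d) B) (n : ℕ) :
    (n : ℝ) * mutualInfoS (rTensor EB M.map φ) -
        mutualInfoS (cqState
          (fun _ : Equiv.Perm (Fin n) × (Fin n → Fin d) =>
            (((n.factorial * d ^ n : ℕ) : ℝ))⁻¹)
          (fun c => permProdState c.1 fun i => rTensor EB M.map (phaseConj d (c.2 i) φ)))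
      ≤ (d : ℝ) * Real.logb 2 (n + 1) := by
  obtain ⟨v, hv⟩ := hpure
  let V : Matrix EB (Fin d) ℂ := Matrix.of fun e a => v (a, e)
  have hφV : ∀ a a' e e', φ (a, e) (a', e') = V e a * star (V e' a') := fun a a' e e' => by
    rw [hv]; rfl
  have hV : Vᴴ * V = Matrix.diagonal fun z => (lam z : ℂ) := by
    ext a a'
    calc (Vᴴ * V) a a' = ptrR φ a' a := by
          simp only [Matrix.mul_apply, ptrR, Matrix.of_apply, hφV, Matrix.conjTranspose_apply]
          exact Finset.sum_congr rfl fun e _ => mul_comm _ _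
      _ = _ := by
          rw [hspec]
          by_cases h : a = a'
          · rw [h]
          · rw [Matrix.diagonal_apply_ne _ h, Matrix.diagonal_apply_ne' _ h]
  have hlam : ∀ a, 0 ≤ lam a := fun a => by
    have h := (Matrix.posSemidef_conjTranspose_mul_self V).diag_nonneg (i := a)
    rw [hV, Matrix.diagonal_apply_eq] at h
    exact Complex.zero_le_real.1 h
  have hlam1 : ∑ a, lam a = 1 := by
    have h : ∑ a, ptrR φ a a = 1 := by
      rw [← hφ.2, Matrix.trace, Fintype.sum_prod_type]; rfl
    simp only [hspec, Matrix.diagonal_apply_eq] at h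
    exact_mod_cast h
  set τ : Fin d → Matrix (B × EB) (B × EB) ℂ := fun u => rTensor EB M.map (phaseConj d u φ) with hτ
  have hτH : ∀ u, (τ u).IsHermitian := rTensor_phaseConj_isHermitian M hφV
  have hτt : ∀ u, (τ u).trace = 1 := trace_rTensor_phaseConj M hφ.2
  have hσ : rTensor EB M.map φ = τ ⟨0, hd⟩ := by
    refine congrArg _ (Matrix.ext fun p q => ?_)
    rw [phaseConj_apply]
    simp [phase]
  have hτs : ∀ u, specSum (τ u) = specSum (rTensor EB M.map φ) := fun u => by
    rw [hσ, hτ]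
    simp only [specSum_rTensor_phaseConj M hφV hV]
  have hN : (∑ a, (lam a : ℂ) • basisOut M a).PosSemidef := Matrix.posSemidef_sum _ fun a _ =>
    (basisOut_posSemidef M a).smul (Complex.zero_le_real.2 (hlam a))
  have hNt : (∑ a, (lam a : ℂ) • basisOut M a).trace = 1 := by
    simp only [Matrix.trace_sum, Matrix.trace_smul, trace_basisOut, smul_eq_mul, mul_one]
    exact_mod_cast hlam1
  have hI : mutualInfoS (rTensor EB M.map φ) = specSum (∑ a, (lam a : ℂ) • basisOut M a) +
      ∑ a, eta (lam a) - specSum (rTensor EB M.map φ) := by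
    rw [mutualInfoS, ptrR_rTensor M hspec, ptrL_rTensor M hφV, entropy_eq_specSum hN.isHermitian,
      entropy_eq_specSum (Matrix.isHermitian_mul_conjTranspose_self V), specSum_mul_comm, hV,
      specSum_diagonal, entropy_eq_specSum (hσ ▸ hτH _)]
    simp only [Complex.ofReal_re]
  have hω : ∀ c : Equiv.Perm (Fin n) × (Fin n → Fin d),
      specSum (permProdState c.1 fun i => τ (c.2 i)) = n * specSum (rTensor EB M.map φ) :=
    fun c => by
      rw [permProdState_eq_submatrix, specSum_reindex, specSum_piMat (fun i => hτH _) fun i => hτt _]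
      simp [hτs]
  have hQ : specSum (∑ c : Equiv.Perm (Fin n) × (Fin n → Fin d),
      ((((n.factorial * d ^ n : ℕ) : ℝ)⁻¹ : ℝ) : ℂ) • permProdState c.1 fun i => τ (c.2 i)) =
      ∑ z : Fin n → Fin d, (∏ i, lam (z i)) * specSum (symAvg (basisOut M) z) +
        n * ∑ a, eta (lam a) := by
    have hVn : (piMat fun _ : Fin n => V)ᴴ * (piMat fun _ : Fin n => V) =
        Matrix.diagonal fun z => ((∏ i, lam (z i) : ℝ) : ℂ) := by
      rw [piMat_conjTranspose, piMat_mul]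
      simp only [hV]
      rw [piMat_diagonal]
      push_cast; rfl
    have hblock : Matrix.blockDiagonal (fun z : Fin n → Fin d => symAvg (basisOut M) z) *
        ((1 : Matrix (Fin n → B) (Fin n → B) ℂ) ⊗ₖ
          Matrix.diagonal fun z => ((∏ i, lam (z i) : ℝ) : ℂ)) =
        Matrix.blockDiagonal fun z : Fin n → Fin d =>
          ((∏ i, lam (z i) : ℝ) : ℂ) • symAvg (basisOut M) z := by
      rw [← Matrix.diagonal_one, Matrix.diagonal_kronecker_diagonal]
      ext ⟨p, z⟩ ⟨q, w⟩
      rw [Matrix.mul_diagonal, Matrix.blockDiagonal_apply, Matrix.blockDiagonal_apply]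
      by_cases h : z = w
      · subst h
        simp [mul_comm]
      · simp [h]
    rw [average_permProdState M hd n hφV, specSum_one_kronecker_conj, hVn, hblock,
      specSum_blockDiagonal]
    simp only [specSum_smul (symAvg_posSemidef (basisOut_posSemidef M) _).isHermitian,
      trace_symAvg (trace_basisOut M), Complex.one_re, mul_one, Finset.sum_add_distrib]
    rw [sum_eta_prod (fun _ : Fin n => lam) fun _ => hlam1]
    simp
  have hcard : ((n.factorial * d ^ n : ℕ) : ℝ) ≠ 0 := by
    exact_mod_cast (Nat.mul_pos n.factorial_pos (pow_pos hd n)).ne'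
  have hJ : mutualInfoS (cqState
      (fun _ : Equiv.Perm (Fin n) × (Fin n → Fin d) => (((n.factorial * d ^ n : ℕ) : ℝ))⁻¹)
      (fun c => permProdState c.1 fun i => τ (c.2 i))) =
      ∑ z : Fin n → Fin d, (∏ i, lam (z i)) * specSum (symAvg (basisOut M) z) +
        n * ∑ a, eta (lam a) - n * specSum (rTensor EB M.map φ) := by
    rw [mutualInfoS_cqState (fun c => ?_) fun c => ?_, hQ]
    · simp only [hω, Finset.sum_const, Finset.card_univ, Fintype.card_prod, Fintype.card_perm,
        Fintype.card_fin, Fintype.card_fun, nsmul_eq_mul]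
      rw [mul_inv_cancel_left₀ hcard]
    · rw [permProdState_eq_submatrix]
      exact (piMat_isHermitian fun i => hτH _).submatrix _
    · rw [trace_permProdState]
      exact Finset.prod_eq_one fun i _ => hτt _
  have hkey := specSum_piMat_le_symAvg (n := n) (basisOut_posSemidef M) (trace_basisOut M) hlam hlam1
  rw [specSum_piMat (fun _ => hN.isHermitian) fun _ => hNt] at hkey
  simp only [Finset.sum_const, Finset.card_univ, Fintype.card_fin, nsmul_eq_mul] at hkey
  rw [hI, hJ]
  linarith

end QIT
end
end

section
/- Let E_{d,p} be the qudit erasure channel E_{d,p}(ρ) = (1−p)ρ + p|e⟩⟨e| with p ∈ [0,1], where |e⟩ is orthogonal to the d-dimensional input space, and let Φ_λ = |Φ_λ⟩⟨Φ_λ| with |Φ_λ⟩ = Σ_{i=1}^d √λ_i |ii⟩ be a two-qudit pure state (λ_i ≥ 0, Σ_i λ_i = 1). Then the minimum output entropy over local encodings satisfies min_{E_{E_A→A}} S( (E_{d,p}∘E ⊗ id)(Φ_λ) ) = h(p) + p·H(λ), where h is the binary entropy and H(λ) = −Σ_i λ_i log λ_i; consequently χ_{Φ_λ}(E_{d,p})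 = I_{Φ_λ}(E_{d,p}) = (1−p)(log d + H(λ)). -/
open scoped Kronecker ComplexOrder
open Matrix

noncomputable section

namespace QIT

/-- The two-qudit pure entangled state `|Φ_λ⟩ = Σ_i √λ_i |ii⟩`. -/
def phiLam {d : ℕ} (lam : Fin d → ℝ) :
    Matrix ((Fin d) × (Fin d)) ((Fin d) × (Fin d)) ℂ :=
  Matrix.of fun a b =>
    if a.1 = a.2 ∧ b.1 = b.2
    then ((Real.sqrt (lam a.1) * Real.sqrt (lam b.1) : ℝ) : ℂ) else 0

section EntropyLemmas

variable {ι κ : Type*}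

theorem shannonEnt_eq_sum_negMulLog {ι : Type*} [Fintype ι] (f : ι → ℝ) :
    shannonEnt f = (∑ i, Real.negMulLog (f i)) / Real.log 2 := by
  simp only [shannonEnt, Real.negMulLog, Real.logb, Finset.sum_div, ← Finset.sum_neg_distrib]
  exact Finset.sum_congr rfl fun i _ => by ring

theorem isHermitian_eq_conj [Fintype ι] [DecidableEq ι] {ρ : Matrix ι ι ℂ} (h : ρ.IsHermitian) :
    ρ = (h.eigenvectorUnitary : Matrix ι ι ℂ) *
      Matrix.diagonal (fun i => (h.eigenvalues i : ℂ)) *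
      star (h.eigenvectorUnitary : Matrix ι ι ℂ) := by
  conv_lhs => rw [h.spectral_theorem]
  rw [Unitary.conjStarAlgAut_apply]
  rfl

theorem entropy_eq_eigenvalues [Fintype ι] [DecidableEq ι] {ρ : Matrix ι ι ℂ} (h : ρ.IsHermitian) :
    entropy ρ = shannonEnt h.eigenvalues := by
  set U : Matrix ι ι ℂ := ↑h.eigenvectorUnitary with hU
  have hUU : star U * U = 1 := Unitary.coe_star_mul_self h.eigenvectorUnitary
  have h1 : ρ * matLog ρ = U * (Matrix.diagonal (fun i => (h.eigenvalues i : ℂ)) *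
      Matrix.diagonal (fun i => (Real.logb 2 (h.eigenvalues i) : ℂ))) * star U := by
    rw [matLog, dif_pos h, ← hU]
    conv_lhs => arg 1; rw [isHermitian_eq_conj h, ← hU]
    calc _ = U * Matrix.diagonal (fun i => (h.eigenvalues i : ℂ)) * (star U * U) *
          Matrix.diagonal (fun i => (Real.logb 2 (h.eigenvalues i) : ℂ)) * star U := by
          simp only [mul_assoc]
      _ = _ := by rw [hUU]; simp only [mul_assoc, one_mul]
  rw [entropy, h1, Matrix.trace_mul_comm, ← mul_assoc, hUU, one_mul, Matrix.diagonal_mul_diagonal,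
    Matrix.trace_diagonal, shannonEnt]
  simp only [← Complex.ofReal_mul, ← Complex.ofReal_sum, Complex.ofReal_re]

theorem entropy_eq_of_charpoly [Fintype ι] [DecidableEq ι] [Fintype κ] {ρ : Matrix ι ι ℂ} (h : ρ.IsHermitian) (f : κ → ℝ)
    (hf : ρ.charpoly = ∏ k, (Polynomial.X - Polynomial.C (f k : ℂ))) :
    entropy ρ = shannonEnt f := by
  have h1 := h.roots_charpoly_eq_eigenvalues
  have h2 : (∏ k, (Polynomial.X - Polynomial.C (f k : ℂ))).roots =
      Finset.univ.val.map fun k => (f k : ℂ) := by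
    rw [← Polynomial.roots_multiset_prod_X_sub_C (Finset.univ.val.map fun k => (f k : ℂ)),
      Multiset.map_map]
    rfl
  rw [hf, h2] at h1
  have h3 := congrArg (fun s => (s.map fun z : ℂ => z.re * Real.logb 2 z.re).sum) h1
  simp only [Multiset.map_map] at h3
  rw [entropy_eq_eigenvalues h, shannonEnt, shannonEnt]
  exact congrArg Neg.neg h3.symm

theorem charpoly_smul_of_isHermitian [Fintype ι] [DecidableEq ι] {ρ : Matrix ι ι ℂ} (h : ρ.IsHermitian) (c : ℝ) :
    ((c : ℂ) • ρ).charpoly =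
      ∏ i, (Polynomial.X - Polynomial.C ((c * h.eigenvalues i : ℝ) : ℂ)) := by
  set U : Matrix ι ι ℂ := ↑h.eigenvectorUnitary with hU
  have hUU : star U * U = 1 := Unitary.coe_star_mul_self h.eigenvectorUnitary
  conv_lhs => rw [isHermitian_eq_conj h, ← hU]
  rw [← Matrix.smul_mul, Matrix.charpoly_mul_comm, ← Matrix.mul_smul, ← mul_assoc, hUU, one_mul,
    ← Matrix.diagonal_smul, Matrix.charpoly_diagonal]
  simp

theorem isHermitian_real_smul {ρ : Matrix ι ι ℂ} (h : ρ.IsHermitian) (c : ℝ) :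
    ((c : ℂ) • ρ).IsHermitian := by
  rw [Matrix.IsHermitian, Matrix.conjTranspose_smul, h.eq]
  simp

theorem sum_eigenvalues_eq_trace [Fintype ι] [DecidableEq ι] {ρ : Matrix ι ι ℂ} (h : ρ.IsHermitian) :
    ∑ i, h.eigenvalues i = ρ.trace.re := by
  rw [h.trace_eq_sum_eigenvalues]
  simp

theorem entropy_smul [Fintype ι] [DecidableEq ι] {ρ : Matrix ι ι ℂ} (h : ρ.IsHermitian) (ht : ρ.trace = 1) (c : ℝ) :
    entropy ((c : ℂ) • ρ) = c * entropy ρ - c * Real.logb 2 c := by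
  rw [entropy_eq_of_charpoly (isHermitian_real_smul h c) _ (charpoly_smul_of_isHermitian h c),
    entropy_eq_eigenvalues h, shannonEnt_eq_sum_negMulLog, shannonEnt_eq_sum_negMulLog]
  simp only [Real.negMulLog_mul, Finset.sum_add_distrib, ← Finset.sum_mul, ← Finset.mul_sum]
  rw [sum_eigenvalues_eq_trace h, ht, Real.negMulLog, Real.logb]
  simp
  ring

theorem entropy_submatrix_equiv [Fintype ι] [DecidableEq ι] [Fintype κ] [DecidableEq κ] {ρ : Matrix ι ι ℂ} (h : ρ.IsHermitian) (e : κ ≃ ι) :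
    entropy (ρ.submatrix e e) = entropy ρ := by
  rw [entropy_eq_eigenvalues h]
  refine entropy_eq_of_charpoly (h.submatrix e) _ ?_
  refine Eq.trans ?_ h.charpoly_eq
  rw [← Matrix.charpoly_reindex e.symm ρ]
  rfl

theorem entropy_fromBlocks [Fintype ι] [DecidableEq ι] [Fintype κ] [DecidableEq κ] {A : Matrix ι ι ℂ} {D : Matrix κ κ ℂ} (hA : A.IsHermitian)
    (hD : D.IsHermitian) :
    entropy (Matrix.fromBlocks A 0 0 D) = entropy A + entropy D := by
  have hH : (Matrix.fromBlocks A 0 0 D).IsHermitian :=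
    Matrix.IsHermitian.fromBlocks hA (by simp) hD
  rw [entropy_eq_of_charpoly hH (Sum.elim hA.eigenvalues hD.eigenvalues) ?_,
    entropy_eq_eigenvalues hA, entropy_eq_eigenvalues hD]
  · simp [shannonEnt, Fintype.sum_sum_type]; ring
  · rw [Matrix.charpoly_fromBlocks_zero₁₂, hA.charpoly_eq, hD.charpoly_eq, Fintype.prod_sum_type]
    rfl

theorem charpoly_cqState [Fintype ι] [DecidableEq ι] [Fintype κ] [DecidableEq κ] (q : κ → ℝ) (σ : κ → Matrix ι ι ℂ) :
    (cqState q σ).charpoly = ∏ x, ((q x : ℂ) • σ x).charpoly := by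
  rw [← Matrix.charpoly_reindex (Equiv.prodComm κ ι)]
  simp only [Matrix.charpoly]
  rw [← Matrix.det_blockDiagonal]
  congr 1
  ext ⟨i, x⟩ ⟨j, y⟩ : 1
  rw [Matrix.blockDiagonal_apply]
  by_cases hxy : x = y
  · subst hxy
    simp [Matrix.charmatrix, Matrix.diagonal_apply, cqState]
  · simp [Matrix.charmatrix, cqState, hxy]

theorem isHermitian_cqState [DecidableEq κ] (q : κ → ℝ) {σ : κ → Matrix ι ι ℂ} (h : ∀ x, (σ x).IsHermitian) :
    (cqState q σ).IsHermitian := by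
  ext ⟨x, i⟩ ⟨y, j⟩
  by_cases hxy : x = y
  · subst hxy
    simpa [cqState] using Or.inl ((h x).apply i j)
  · simp [cqState, hxy, Ne.symm hxy]

theorem entropy_cqState [Fintype ι] [DecidableEq ι] [Fintype κ] [DecidableEq κ] (q : κ → ℝ) {σ : κ → Matrix ι ι ℂ} (h : ∀ x, (σ x).IsHermitian)
    (ht : ∀ x, (σ x).trace = 1) :
    entropy (cqState q σ) = shannonEnt q + ∑ x, q x * entropy (σ x) := by
  rw [entropy_eq_of_charpoly (isHermitian_cqState q h)
    (fun k : κ × ι => q k.1 * (h k.1).eigenvalues k.2) ?_]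
  · have key (x : κ) : -∑ i, q x * (h x).eigenvalues i * Real.logb 2 (q x * (h x).eigenvalues i) =
        q x * entropy (σ x) - q x * Real.logb 2 (q x) := by
      rw [← entropy_smul (h x) (ht x), entropy_eq_of_charpoly (isHermitian_real_smul (h x) _) _
        (charpoly_smul_of_isHermitian (h x) _), shannonEnt]
    rw [shannonEnt, Fintype.sum_prod_type, ← Finset.sum_neg_distrib]
    simp only [key, shannonEnt, Finset.sum_sub_distrib]
    ring
  · simp only [charpoly_cqState, charpoly_smul_of_isHermitian (h _), Fintype.prod_prod_type]

theorem isHermitian_diagonal_ofReal [DecidableEq ι] (f : ι → ℝ) :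
    (Matrix.diagonal fun i => (f i : ℂ)).IsHermitian := by
  simp [Matrix.IsHermitian, Matrix.diagonal_conjTranspose, Pi.star_def]

theorem entropy_diagonal [Fintype ι] [DecidableEq ι] (f : ι → ℝ) :
    entropy (Matrix.diagonal fun i => (f i : ℂ)) = shannonEnt f :=
  entropy_eq_of_charpoly (isHermitian_diagonal_ofReal f) f (Matrix.charpoly_diagonal _)

theorem shannonEnt_nonneg [Fintype ι] {f : ι → ℝ} (h : IsProbDist f) : 0 ≤ shannonEnt f := by
  rw [shannonEnt_eq_sum_negMulLog]
  refine div_nonneg (Finset.sum_nonneg fun i _ => Real.negMulLog_nonneg (h.1 i) ?_)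
    (Real.log_nonneg one_le_two)
  rw [← h.2]
  exact Finset.single_le_sum (fun j _ => h.1 j) (Finset.mem_univ i)

theorem entropy_nonneg [Fintype ι] [DecidableEq ι] {ρ : Matrix ι ι ℂ} (h : IsState ρ) : 0 ≤ entropy ρ := by
  rw [entropy_eq_eigenvalues h.1.isHermitian]
  refine shannonEnt_nonneg ⟨h.1.eigenvalues_nonneg, ?_⟩
  rw [sum_eigenvalues_eq_trace, h.2, Complex.one_re]

theorem entropy_eq_zero_of_idempotent [Fintype ι] [DecidableEq ι] {ρ : Matrix ι ι ℂ} (h : ρ.IsHermitian)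
    (hi : ρ * ρ = ρ) : entropy ρ = 0 := by
  rw [entropy_eq_eigenvalues h, shannonEnt_eq_sum_negMulLog, Finset.sum_eq_zero, zero_div]
  intro i _
  have h1 := h.mulVec_eigenvectorBasis i
  have h2 : ρ *ᵥ (ρ *ᵥ (h.eigenvectorBasis i).ofLp) = ρ *ᵥ (h.eigenvectorBasis i).ofLp := by
    rw [Matrix.mulVec_mulVec, hi]
  rw [h1, Matrix.mulVec_smul, h1, smul_smul] at h2
  have h3 : (h.eigenvectorBasis i).ofLp ≠ 0 := by
    have := h.eigenvectorBasis.orthonormal.ne_zero i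
    simpa using this
  have h4 : h.eigenvalues i * h.eigenvalues i = h.eigenvalues i := smul_left_injective ℝ h3 h2
  rcases IsIdempotentElem.iff_eq_zero_or_one.mp h4 with h5 | h5 <;> simp [h5]

/-- Dephasing in the computational basis does not decrease the entropy. -/
theorem entropy_le_shannonEnt_diag [Fintype ι] [DecidableEq ι] {ρ : Matrix ι ι ℂ} (h : ρ.PosSemidef) :
    entropy ρ ≤ shannonEnt fun i => (ρ i i).re := by
  have hH := h.isHermitian
  set U : Matrix ι ι ℂ := ↑hH.eigenvectorUnitary with hU
  have h1 : star U * U = 1 := Unitary.coe_star_mul_self hH.eigenvectorUnitary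
  have h2 : U * star U = 1 := Unitary.coe_mul_star_self hH.eigenvectorUnitary
  have hrow (i : ι) : ∑ j, Complex.normSq (U i j) = 1 := by
    have := congrFun (congrFun h2 i) i
    simp only [Matrix.mul_apply, Matrix.star_apply, Matrix.one_apply_eq, RCLike.star_def,
      Complex.mul_conj] at this
    exact_mod_cast this
  have hcol (j : ι) : ∑ i, Complex.normSq (U i j) = 1 := by
    have := congrFun (congrFun h1 j) j
    simp only [Matrix.mul_apply, Matrix.star_apply, Matrix.one_apply_eq, RCLike.star_def,
      ← Complex.normSq_eq_conj_mul_self] at this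
    exact_mod_cast this
  have hdiag (i : ι) : (ρ i i).re = ∑ j, Complex.normSq (U i j) * hH.eigenvalues j := by
    conv_lhs => rw [isHermitian_eq_conj hH, ← hU]
    rw [Matrix.mul_apply, Complex.re_sum]
    refine Finset.sum_congr rfl fun j _ => ?_
    rw [Matrix.mul_diagonal, Matrix.star_apply, RCLike.star_def, mul_right_comm, Complex.mul_conj]
    norm_cast
  rw [entropy_eq_eigenvalues hH, shannonEnt_eq_sum_negMulLog, shannonEnt_eq_sum_negMulLog]
  refine div_le_div_of_nonneg_right ?_ (Real.log_nonneg one_le_two)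
  calc ∑ j, Real.negMulLog (hH.eigenvalues j)
      = ∑ i, ∑ j, Complex.normSq (U i j) * Real.negMulLog (hH.eigenvalues j) := by
        rw [Finset.sum_comm]
        simp only [← Finset.sum_mul, hcol, one_mul]
    _ ≤ _ := by
        refine Finset.sum_le_sum fun i _ => ?_
        rw [hdiag]
        exact Real.concaveOn_negMulLog.le_map_sum (fun j _ => Complex.normSq_nonneg _) (hrow i)
          (fun j _ => h.eigenvalues_nonneg j)

theorem sum_negMulLog_le [Fintype ι] [Nonempty ι] {f : ι → ℝ} (hf : ∀ i, 0 ≤ f i) :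
    ∑ i, Real.negMulLog (f i) ≤
      Real.negMulLog (∑ i, f i) + (∑ i, f i) * Real.log (Fintype.card ι) := by
  have hc : (0 : ℝ) < Fintype.card ι := Nat.cast_pos.mpr Fintype.card_pos
  have h := Real.concaveOn_negMulLog.le_map_sum (t := Finset.univ)
    (w := fun _ : ι => (Fintype.card ι : ℝ)⁻¹) (p := f) (fun i _ => by positivity)
    (by simp [hc.ne']) (fun i _ => hf i)
  simp only [smul_eq_mul, ← Finset.mul_sum, Real.negMulLog_mul] at h
  have h2 := mul_le_mul_of_nonneg_left h hc.le
  rw [mul_inv_cancel_left₀ hc.ne'] at h2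
  refine h2.trans_eq ?_
  rw [Real.negMulLog, Real.log_inv]
  field_simp
  ring

/-- The entropy of a joint distribution is at most the entropy of a marginal plus the logarithm
of the size of the other alphabet. -/
theorem shannonEnt_prod_le [Fintype ι] [Fintype κ] [Nonempty ι] {f : ι × κ → ℝ} (hf : ∀ k, 0 ≤ f k) (g : κ → ℝ)
    (hfg : ∀ b, ∑ a, f (a, b) = g b) (hg : ∑ b, g b = 1) :
    shannonEnt f ≤ Real.logb 2 (Fintype.card ι) + shannonEnt g := by
  rw [shannonEnt_eq_sum_negMulLog, shannonEnt_eq_sum_negMulLog, Real.logb, ← add_div]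
  refine div_le_div_of_nonneg_right ?_ (Real.log_nonneg one_le_two)
  rw [Fintype.sum_prod_type_right]
  refine (Finset.sum_le_sum fun b _ => sum_negMulLog_le fun a => hf (a, b)).trans_eq ?_
  simp only [hfg, Finset.sum_add_distrib, ← Finset.sum_mul, hg]
  ring

theorem posSemidef_re_diag_nonneg {ρ : Matrix ι ι ℂ} (h : ρ.PosSemidef) (i : ι) :
    0 ≤ (ρ i i).re :=
  (Complex.le_def.mp (h.diag_nonneg (i := i))).1

theorem entropy_le_logb_card [Fintype ι] [DecidableEq ι] [Nonempty ι] {ρ : Matrix ι ι ℂ} (h : IsState ρ) :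
    entropy ρ ≤ Real.logb 2 (Fintype.card ι) := by
  refine (entropy_le_shannonEnt_diag h.1).trans ?_
  rw [shannonEnt_eq_sum_negMulLog, Real.logb]
  refine div_le_div_of_nonneg_right ?_ (Real.log_nonneg one_le_two)
  refine (sum_negMulLog_le (posSemidef_re_diag_nonneg h.1)).trans_eq ?_
  have : ∑ i, (ρ i i).re = 1 := by
    rw [← Complex.re_sum]
    exact congrArg Complex.re h.2
  simp [this]

theorem entropy_le_of_ptrL_eq_diagonal [Fintype ι] [DecidableEq ι] [Fintype κ] [DecidableEq κ] [Nonempty ι] {ρ : Matrix (ι × κ) (ι × κ) ℂ}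
    (h : ρ.PosSemidef) {g : κ → ℝ} (hg : ∑ b, g b = 1)
    (hρ : ptrL ρ = Matrix.diagonal fun b => (g b : ℂ)) :
    entropy ρ ≤ Real.logb 2 (Fintype.card ι) + shannonEnt g := by
  refine (entropy_le_shannonEnt_diag h).trans
    (shannonEnt_prod_le (posSemidef_re_diag_nonneg h) g (fun b => ?_) hg)
  have := congrArg Complex.re (congrFun (congrFun hρ b) b)
  simpa [ptrL] using this

end EntropyLemmas

section ChannelLemmas

variable {α β γ κ : Type*}

/-- The channel `ρ ↦ U ρ U†` for a unitary `U`. -/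
def conjChannel [Fintype α] [DecidableEq α] (U : Matrix α α ℂ) (hU : Uᴴ * U = 1) :
    QChannel α α where
  map :=
    { toFun := fun ρ => U * ρ * Uᴴ
      map_add' := fun ρ σ => by rw [mul_add, add_mul]
      map_smul' := fun c ρ => by simp }
  cp n ρ h := by
    convert h.mul_mul_conjTranspose_same ((1 : Matrix (Fin n) (Fin n) ℂ) ⊗ₖ U) using 1
    ext ⟨k, i⟩ ⟨l, j⟩
    simp [lTensor, Matrix.mul_apply, Fintype.sum_prod_type, Matrix.one_apply, Finset.sum_mul,
      apply_ite, ite_mul]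
  tp ρ := by
    change (U * ρ * Uᴴ).trace = _
    rw [Matrix.trace_mul_comm, ← mul_assoc, hU, one_mul]

theorem rTensor_posSemidef [Fintype α] [DecidableEq α] [Fintype β] [DecidableEq β] {m : ℕ}
    (E : QChannel α β) {ρ : Matrix (α × Fin m) (α × Fin m) ℂ} (h : ρ.PosSemidef) :
    (rTensor (Fin m) E.map ρ).PosSemidef :=
  (E.cp m (ρ.submatrix Prod.swap Prod.swap) (h.submatrix _)).submatrix Prod.swap

theorem ptrL_rTensor_s19 [Fintype α] [DecidableEq α] [Fintype β] [DecidableEq β]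
    (E : QChannel α β) (ρ : Matrix (α × γ) (α × γ) ℂ) :
    ptrL (rTensor γ E.map ρ) = ptrL ρ := by
  ext b b'
  exact E.tp (Matrix.of fun a a' => ρ (a, b) (a', b'))

theorem trace_ptrL [Fintype α] [Fintype γ] (ρ : Matrix (α × γ) (α × γ) ℂ) :
    (ptrL ρ).trace = ρ.trace := by
  simp [ptrL, Matrix.trace, Fintype.sum_prod_type_right]

theorem trace_ptrR [Fintype α] [Fintype γ] (ρ : Matrix (α × γ) (α × γ) ℂ) :
    (ptrR ρ).trace = ρ.trace := by
  simp [ptrR, Matrix.trace, Fintype.sum_prod_type]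

theorem ptrL_posSemidef [Fintype α] {ρ : Matrix (α × γ) (α × γ) ℂ} (h : ρ.PosSemidef) :
    (ptrL ρ).PosSemidef := by
  have : ptrL ρ = ∑ a, ρ.submatrix (fun b => (a, b)) (fun b => (a, b)) := by
    ext b b'
    simp [ptrL, Matrix.sum_apply]
  rw [this]
  exact Matrix.posSemidef_sum _ fun a _ => h.submatrix _

theorem ptrR_posSemidef [Fintype γ] {ρ : Matrix (α × γ) (α × γ) ℂ} (h : ρ.PosSemidef) :
    (ptrR ρ).PosSemidef := by
  have : ptrR ρ = ∑ b, ρ.submatrix (fun a => (a, b)) (fun a => (a, b)) := by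
    ext b b'
    simp [ptrR, Matrix.sum_apply]
  rw [this]
  exact Matrix.posSemidef_sum _ fun a _ => h.submatrix _

theorem isState_ptrL [Fintype α] [Fintype γ] {ρ : Matrix (α × γ) (α × γ) ℂ} (h : IsState ρ) :
    IsState (ptrL ρ) :=
  ⟨ptrL_posSemidef h.1, (trace_ptrL ρ).trans h.2⟩

theorem isState_ptrR [Fintype α] [Fintype γ] {ρ : Matrix (α × γ) (α × γ) ℂ} (h : IsState ρ) :
    IsState (ptrR ρ) :=
  ⟨ptrR_posSemidef h.1, (trace_ptrR ρ).trans h.2⟩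

theorem isState_rTensor [Fintype α] [DecidableEq α] [Fintype β] [DecidableEq β] {m : ℕ}
    (E : QChannel α β) {ρ : Matrix (α × Fin m) (α × Fin m) ℂ} (h : IsState ρ) :
    IsState (rTensor (Fin m) E.map ρ) :=
  ⟨rTensor_posSemidef E h.1, by rw [← trace_ptrL, ptrL_rTensor_s19, trace_ptrL, h.2]⟩

theorem isState_sum_smul [Fintype α] [Fintype κ] {q : κ → ℝ} (hq : IsProbDist q)
    {σ : κ → Matrix α α ℂ} (h : ∀ x, IsState (σ x)) : IsState (∑ x, (q x : ℂ) • σ x) := by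
  refine ⟨Matrix.posSemidef_sum _ fun x _ => (h x).1.smul (by exact_mod_cast hq.1 x), ?_⟩
  simp only [Matrix.trace_sum, Matrix.trace_smul, (h _).2, smul_eq_mul, mul_one]
  exact_mod_cast hq.2

theorem entropy_of_isPure [Fintype α] [DecidableEq α] {ρ : Matrix α α ℂ} (h : IsPure ρ)
    (ht : ρ.trace = 1) : entropy ρ = 0 := by
  obtain ⟨v, rfl⟩ := h
  refine entropy_eq_zero_of_idempotent (Matrix.posSemidef_vecMulVec_self_star v).isHermitian ?_
  rw [Matrix.trace_vecMulVec, dotProduct_comm] at ht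
  rw [Matrix.vecMulVec_mul_vecMulVec, ht, one_smul]

theorem ptrR_cqState [Fintype α] [DecidableEq κ] (q : κ → ℝ) {σ : κ → Matrix α α ℂ}
    (ht : ∀ x, (σ x).trace = 1) :
    ptrR (cqState q σ) = Matrix.diagonal fun x => (q x : ℂ) := by
  ext x y
  by_cases hxy : x = y
  · subst hxy
    have := ht x
    rw [Matrix.trace] at this
    simp only [Matrix.diag_apply] at this
    simp [ptrR, cqState, ← Finset.mul_sum, this]
  · simp [ptrR, cqState, hxy]

theorem ptrL_cqState [Fintype κ] [DecidableEq κ] (q : κ → ℝ) (σ : κ → Matrix α α ℂ) :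
    ptrL (cqState q σ) = ∑ x, (q x : ℂ) • σ x := by
  ext i j
  simp [ptrL, cqState, Matrix.sum_apply]

theorem margXE_cqState [Fintype β] [DecidableEq κ] (q : κ → ℝ)
    (σ : κ → Matrix (β × γ) (β × γ) ℂ) :
    margXE (cqState q σ) = cqState q fun x => ptrL (σ x) := by
  ext ⟨x, i⟩ ⟨y, j⟩
  by_cases hxy : x = y <;> simp [margXE, cqState, ptrL, hxy, Finset.mul_sum]

theorem ptrL_sum_smul [Fintype α] [Fintype κ] (q : κ → ℝ)
    (σ : κ → Matrix (α × γ) (α × γ) ℂ) :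
    ptrL (∑ x, (q x : ℂ) • σ x) = ∑ x, (q x : ℂ) • ptrL (σ x) := by
  ext i j
  simp only [ptrL, Matrix.sum_apply, Matrix.smul_apply, Matrix.of_apply, Finset.smul_sum]
  exact Finset.sum_comm

/-- Regrouping `(A ⊕ 1) × C ≃ (A × C) ⊕ C`. -/
def erasureEquiv (α γ : Type*) : (α ⊕ Unit) × γ ≃ (α × γ) ⊕ γ :=
  (Equiv.sumProdDistrib α Unit γ).trans
    (Equiv.sumCongr (Equiv.refl _) (Equiv.punitProd γ))

/-- The state obtained by erasing the first tensor factor with probability `p`. -/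
def erase [Fintype α] (p : ℝ) (σ : Matrix (α × γ) (α × γ) ℂ) :
    Matrix ((α ⊕ Unit) × γ) ((α ⊕ Unit) × γ) ℂ :=
  (Matrix.fromBlocks (((1 - p : ℝ) : ℂ) • σ) 0 0 ((p : ℂ) • ptrL σ)).submatrix
    (erasureEquiv α γ) (erasureEquiv α γ)

theorem isHermitian_erase [Fintype α] (p : ℝ) {σ : Matrix (α × γ) (α × γ) ℂ}
    (h : σ.PosSemidef) : (erase p σ).IsHermitian :=
  (Matrix.IsHermitian.fromBlocks (isHermitian_real_smul h.isHermitian _) (by simp)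
    (isHermitian_real_smul (ptrL_posSemidef h).isHermitian _)).submatrix _

theorem entropy_erase [Fintype α] [DecidableEq α] [Fintype γ] [DecidableEq γ] (p : ℝ)
    {σ : Matrix (α × γ) (α × γ) ℂ} (h : IsState σ) :
    entropy (erase p σ) = binEnt p + (1 - p) * entropy σ + p * entropy (ptrL σ) := by
  have h1 := h.1.isHermitian
  have h2 := (isState_ptrL h).1.isHermitian
  rw [erase, entropy_submatrix_equiv
    (Matrix.IsHermitian.fromBlocks (isHermitian_real_smul h1 _) (by simp)
      (isHermitian_real_smul h2 _)),
    entropy_fromBlocks (isHermitian_real_smul h1 _) (isHermitian_real_smul h2 _),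
    entropy_smul h1 h.2, entropy_smul h2 (isState_ptrL h).2, binEnt]
  ring

theorem ptrL_erase [Fintype α] (p : ℝ) (σ : Matrix (α × γ) (α × γ) ℂ) :
    ptrL (erase p σ) = ptrL σ := by
  ext i j
  simp [ptrL, erase, erasureEquiv, ← Finset.mul_sum]
  ring

theorem ptrR_erase [Fintype α] [Fintype γ] (p : ℝ) (σ : Matrix (α × γ) (α × γ) ℂ) :
    ptrR (erase p σ) = Matrix.fromBlocks (((1 - p : ℝ) : ℂ) • ptrR σ) 0 0
      ((p : ℂ) • Matrix.diagonal fun _ => σ.trace) := by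
  ext (i | i) (j | j)
  · simp [ptrR, erase, erasureEquiv, ← Finset.mul_sum]
  · simp [ptrR, erase, erasureEquiv]
  · simp [ptrR, erase, erasureEquiv]
  · rw [← trace_ptrL]
    simp [ptrR, erase, erasureEquiv, ← Finset.mul_sum, Matrix.trace]

theorem trace_erase [Fintype α] [Fintype γ] (p : ℝ) (σ : Matrix (α × γ) (α × γ) ℂ) :
    (erase p σ).trace = σ.trace := by
  rw [← trace_ptrL, ptrL_erase, trace_ptrL]

theorem entropy_ptrR_erase [Fintype α] [DecidableEq α] [Fintype γ] (p : ℝ)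
    {σ : Matrix (α × γ) (α × γ) ℂ} (h : IsState σ) :
    entropy (ptrR (erase p σ)) = binEnt p + (1 - p) * entropy (ptrR σ) := by
  have h1 := (isState_ptrR h).1.isHermitian
  have h2 : (Matrix.diagonal fun _ : Unit => (1 : ℂ)).IsHermitian := by
    simp [Matrix.IsHermitian]
  have h3 : entropy (Matrix.diagonal fun _ : Unit => (1 : ℂ)) = 0 := by
    have := entropy_diagonal fun _ : Unit => (1 : ℝ)
    simpa [shannonEnt] using this
  rw [ptrR_erase, h.2,
    entropy_fromBlocks (isHermitian_real_smul h1 _) (isHermitian_real_smul h2 _),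
    entropy_smul h1 (isState_ptrR h).2, entropy_smul h2 (by simp), h3, binEnt]
  ring

theorem erase_sum_smul [Fintype α] [Fintype κ] (p : ℝ) (q : κ → ℝ)
    (σ : κ → Matrix (α × γ) (α × γ) ℂ) :
    ∑ x, (q x : ℂ) • erase p (σ x) = erase p (∑ x, (q x : ℂ) • σ x) := by
  ext ⟨i | i, k⟩ ⟨j | j, l⟩
  · simp [erase, erasureEquiv, Matrix.sum_apply, Finset.mul_sum, mul_left_comm]
  · simp [erase, erasureEquiv, Matrix.sum_apply]
  · simp [erase, erasureEquiv, Matrix.sum_apply]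
  · have := congrFun (congrFun (ptrL_sum_smul q σ) k) l
    simp only [Matrix.sum_apply, Matrix.smul_apply, smul_eq_mul] at this
    simp only [erase, erasureEquiv, Matrix.sum_apply, Matrix.smul_apply, smul_eq_mul,
      Matrix.submatrix_apply, Equiv.trans_apply, Equiv.sumProdDistrib_apply_right,
      Equiv.sumCongr_apply, Sum.map_inr, Matrix.fromBlocks_apply₂₂, Equiv.punitProd_apply, this,
      Finset.mul_sum, mul_left_comm]

theorem sum_mul_entropy_erase [Fintype α] [DecidableEq α] [Fintype γ] [DecidableEq γ]
    [Fintype κ] (p : ℝ) {q : κ → ℝ} (hq : IsProbDist q)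
    {σ : κ → Matrix (α × γ) (α × γ) ℂ} (h : ∀ x, IsState (σ x)) {μ : Matrix γ γ ℂ}
    (hμ : ∀ x, ptrL (σ x) = μ) :
    ∑ x, q x * entropy (erase p (σ x)) =
      binEnt p + (1 - p) * ∑ x, q x * entropy (σ x) + p * entropy μ := by
  simp only [entropy_erase p (h _), hμ, mul_add, Finset.sum_add_distrib, ← Finset.sum_mul, hq.2,
    one_mul, Finset.mul_sum, mul_left_comm (q _) (1 - p)]

/-- The Holevo information of an ensemble of erased states with a common unaffected marginal. -/
theorem mutualInfoS_cqState_erase [Fintype α] [DecidableEq α] [Fintype γ] [DecidableEq γ]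
    [Fintype κ] [DecidableEq κ] (p : ℝ) {q : κ → ℝ} (hq : IsProbDist q)
    {σ : κ → Matrix (α × γ) (α × γ) ℂ} (h : ∀ x, IsState (σ x)) {μ : Matrix γ γ ℂ}
    (hμ : ∀ x, ptrL (σ x) = μ) :
    mutualInfoS (cqState q fun x => erase p (σ x)) =
      (1 - p) * (entropy (∑ x, (q x : ℂ) • σ x) - ∑ x, q x * entropy (σ x)) := by
  have ht (x : κ) : (erase p (σ x)).trace = 1 := by rw [trace_erase, (h x).2]
  have hm : ptrL (∑ x, (q x : ℂ) • σ x) = μ := by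
    rw [ptrL_sum_smul]
    simp only [hμ, ← Finset.sum_smul, ← Complex.ofReal_sum, hq.2, Complex.ofReal_one, one_smul]
  rw [mutualInfoS, ptrR_cqState q ht, ptrL_cqState, erase_sum_smul, entropy_diagonal,
    entropy_cqState q (fun x => isHermitian_erase p (h x).1) ht,
    entropy_erase p (isState_sum_smul hq h), hm, sum_mul_entropy_erase p hq h hμ]
  ring

/-- The mutual information `I(XC:B)` of an ensemble of erased states with a common unaffected
marginal. -/
theorem infoXE_B_cqState_erase [Fintype α] [DecidableEq α] [Fintype γ] [DecidableEq γ]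
    [Fintype κ] [DecidableEq κ] (p : ℝ) {q : κ → ℝ} (hq : IsProbDist q)
    {σ : κ → Matrix (α × γ) (α × γ) ℂ} (h : ∀ x, IsState (σ x)) {μ : Matrix γ γ ℂ}
    (hμ : ∀ x, ptrL (σ x) = μ) :
    infoXE_B (cqState q fun x => erase p (σ x)) =
      (1 - p) * (entropy μ + entropy (ptrR (∑ x, (q x : ℂ) • σ x)) -
        ∑ x, q x * entropy (σ x)) := by
  have ht (x : κ) : (erase p (σ x)).trace = 1 := by rw [trace_erase, (h x).2]
  have hs (x : κ) : IsState μ := hμ x ▸ isState_ptrL (h x)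
  rw [infoXE_B, margXE_cqState, ptrL_cqState, erase_sum_smul,
    entropy_ptrR_erase p (isState_sum_smul hq h),
    entropy_cqState q (fun x => isHermitian_erase p (h x).1) ht]
  simp only [ptrL_erase, hμ]
  rw [entropy_cqState q (fun x => (hs x).1.isHermitian) (fun x => (hs x).2),
    sum_mul_entropy_erase p hq h hμ, ← Finset.sum_mul, hq.2]
  ring

end ChannelLemmas

section ErasureAssisted

variable {d : ℕ}

theorem phiLam_eq_vecMulVec (lam : Fin d → ℝ) :
    phiLam lam = Matrix.vecMulVec
      (fun k : Fin d × Fin d => if k.1 = k.2 then ((√(lam k.2) : ℝ) : ℂ) else 0)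
      (star fun k : Fin d × Fin d => if k.1 = k.2 then ((√(lam k.2) : ℝ) : ℂ) else 0) := by
  ext ⟨i, b⟩ ⟨j, c⟩
  by_cases h1 : i = b <;> by_cases h2 : j = c <;> simp [phiLam, Matrix.vecMulVec_apply, h1, h2]

theorem ptrL_phiLam {lam : Fin d → ℝ} (hlam : ∀ i, 0 ≤ lam i) :
    ptrL (phiLam lam) = Matrix.diagonal fun i => (lam i : ℂ) := by
  ext b c
  by_cases h : b = c
  · subst h
    simp [ptrL, phiLam, -Complex.ofReal_mul, Real.mul_self_sqrt (hlam _)]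
  · have (a : Fin d) : ¬(a = b ∧ a = c) := fun h' => h (h'.1.symm.trans h'.2)
    simp [ptrL, phiLam, h, this]

theorem isState_phiLam {lam : Fin d → ℝ} (hlam : ∀ i, 0 ≤ lam i) (hsum : ∑ i, lam i = 1) :
    IsState (phiLam lam) := by
  constructor
  · rw [phiLam_eq_vecMulVec]
    exact Matrix.posSemidef_vecMulVec_self_star _
  · rw [← trace_ptrL, ptrL_phiLam hlam, Matrix.trace_diagonal]
    exact_mod_cast hsum

theorem rTensor_conjChannel_phiLam (lam : Fin d → ℝ) {U : Matrix (Fin d) (Fin d) ℂ}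
    (hU : Uᴴ * U = 1) :
    rTensor (Fin d) (conjChannel U hU).map (phiLam lam) = Matrix.vecMulVec
      (fun k : Fin d × Fin d => U k.1 k.2 * (√(lam k.2) : ℝ))
      (star fun k : Fin d × Fin d => U k.1 k.2 * (√(lam k.2) : ℝ)) := by
  ext ⟨i, b⟩ ⟨j, c⟩
  have h : (Matrix.of fun a a' => phiLam lam (a, b) (a', c)) =
      Matrix.single b c (((√(lam b) : ℝ) : ℂ) * ((√(lam c) : ℝ) : ℂ)) := by
    ext a a'
    by_cases h1 : a = b <;> by_cases h2 : a' = c <;>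
      simp [phiLam, h1, h2, Ne.symm]
  change (U * (Matrix.of fun a a' => phiLam lam (a, b) (a', c)) * Uᴴ) i j = _
  rw [h]
  simp [Matrix.mul_apply, Matrix.single_apply, Matrix.vecMulVec_apply, ite_and]
  ring

theorem entropy_rTensor_conjChannel_phiLam {lam : Fin d → ℝ} (hlam : ∀ i, 0 ≤ lam i)
    (hsum : ∑ i, lam i = 1) {U : Matrix (Fin d) (Fin d) ℂ} (hU : Uᴴ * U = 1) :
    entropy (rTensor (Fin d) (conjChannel U hU).map (phiLam lam)) = 0 :=
  entropy_of_isPure ⟨_, rTensor_conjChannel_phiLam lam hU⟩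
    (isState_rTensor _ (isState_phiLam hlam hsum)).2

/-- The Weyl operators form a unitary error basis. -/
theorem exists_unitary_error_basis (hd : 0 < d) :
    ∃ U : Fin (d * d) → Matrix (Fin d) (Fin d) ℂ, (∀ x, (U x)ᴴ * U x = 1) ∧
      ∀ i j b c, ∑ x, U x i b * star (U x j c) = if i = j ∧ b = c then (d : ℂ) else 0 := by
  have : NeZero d := ⟨hd.ne'⟩
  let e : Fin d ≃ ZMod d := Fintype.equivOfCardEq (by simp)
  let ψ : AddChar (ZMod d) ℂ := ZMod.stdAddChar
  let W : Fin d × Fin d → Matrix (Fin d) (Fin d) ℂ := fun x =>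
    Matrix.of fun i b => if e i = e b + e x.1 then ψ (e x.2 * e b) else 0
  have hψ (s t : ZMod d) : ψ s * star (ψ t) = ψ (s - t) := by
    rw [sub_eq_add_neg, AddChar.map_add_eq_mul, AddChar.map_neg_eq_conj]
    rfl
  have hfib (b : Fin d) (a : Fin d) (f : Fin d → ℂ) :
      ∑ i, (if e i = e b + e a then f i else 0) = f (e.symm (e b + e a)) := by
    simp [← Equiv.eq_symm_apply]
  have hW (x : Fin d × Fin d) : (W x)ᴴ * W x = 1 := by
    obtain ⟨a, u⟩ := x
    ext b c
    have : ((W (a, u))ᴴ * W (a, u)) b c =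
        ∑ i, if e i = e b + e a then
          (if e i = e c + e a then ψ (e u * e c) * star (ψ (e u * e b)) else 0) else 0 := by
      rw [Matrix.mul_apply]
      refine Finset.sum_congr rfl fun i _ => ?_
      simp only [W, Matrix.conjTranspose_apply, Matrix.of_apply]
      split_ifs <;> simp [mul_comm]
    rw [this, hfib]
    by_cases h : b = c
    · subst h
      simpa using hψ (e u * e b) (e u * e b)
    · simp [h]
  refine ⟨fun x => W (finProdFinEquiv.symm x), fun x => hW _, fun i j b c => ?_⟩
  · rw [finProdFinEquiv.symm.sum_comp fun x => W x i b * star (W x j c), Fintype.sum_prod_type]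
    have (a : Fin d) : ∑ u, W (a, u) i b * star (W (a, u) j c) =
        if e i = e b + e a ∧ e j = e c + e a then (if b = c then (d : ℂ) else 0) else 0 := by
      by_cases h1 : e i = e b + e a <;> by_cases h2 : e j = e c + e a <;> simp [W, h1, h2]
      have h3 := e.sum_comp fun u => ψ (u * (e b - e c))
      rw [AddChar.sum_mulShift _ (ZMod.isPrimitive_stdAddChar d)] at h3
      simp only [RCLike.star_def] at hψ
      simpa [hψ, ← mul_sub, sub_eq_zero] using h3
    simp only [this]
    by_cases hbc : b = c
    · subst hbc
      by_cases hij : i = j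
      · subst hij
        have := e.sum_comp fun a => if e i = e b + a then (d : ℂ) else 0
        simpa [← sub_eq_iff_eq_add'] using this
      · have (a : Fin d) : ¬(e i = e b + e a ∧ e j = e b + e a) :=
          fun h => hij (e.injective (h.1.trans h.2.symm))
        simp [hij, this]
    · simp [hbc]

theorem sum_smul_rTensor_conjChannel_phiLam (hd : 0 < d) {lam : Fin d → ℝ}
    (hlam : ∀ i, 0 ≤ lam i) {U : Fin (d * d) → Matrix (Fin d) (Fin d) ℂ}
    (hU : ∀ x, (U x)ᴴ * U x = 1)
    (hU' : ∀ i j b c, ∑ x, U x i b * star (U x j c) = if i = j ∧ b = c then (d : ℂ) else 0) :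
    ∑ x, (((d * d : ℝ)⁻¹ : ℝ) : ℂ) •
        rTensor (Fin d) (conjChannel (U x) (hU x)).map (phiLam lam) =
      Matrix.diagonal fun k : Fin d × Fin d => ((lam k.2 / d : ℝ) : ℂ) := by
  ext ⟨i, b⟩ ⟨j, c⟩
  have hd' : (d : ℂ) ≠ 0 := by exact_mod_cast hd.ne'
  have key : ∑ x, (U x i b * (√(lam b) : ℝ)) * star (U x j c * (√(lam c) : ℝ)) =
      (if i = j ∧ b = c then (d : ℂ) else 0) * ((√(lam b) : ℝ) * (√(lam c) : ℝ)) := by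
    rw [← hU', Finset.sum_mul]
    refine Finset.sum_congr rfl fun x _ => ?_
    simp
    ring
  simp only [rTensor_conjChannel_phiLam, Matrix.sum_apply, Matrix.smul_apply, smul_eq_mul,
    Matrix.vecMulVec_apply, Pi.star_apply, ← Finset.mul_sum, key]
  by_cases h : i = j ∧ b = c
  · obtain ⟨rfl, rfl⟩ := h
    rw [if_pos ⟨rfl, rfl⟩, ← Complex.ofReal_mul, Real.mul_self_sqrt (hlam _),
      Matrix.diagonal_apply_eq]
    push_cast
    field_simp
  · simp [h]

theorem shannonEnt_uniform (hd : 0 < d) :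
    shannonEnt (fun _ : Fin d => (d : ℝ)⁻¹) = Real.logb 2 d := by
  have hd' : (d : ℝ) ≠ 0 := by exact_mod_cast hd.ne'
  simp [shannonEnt, hd']

theorem shannonEnt_prod_uniform (hd : 0 < d) {lam : Fin d → ℝ} (hsum : ∑ i, lam i = 1) :
    shannonEnt (fun k : Fin d × Fin d => lam k.2 / d) = Real.logb 2 d + shannonEnt lam := by
  have hd' : (d : ℝ) ≠ 0 := by exact_mod_cast hd.ne'
  simp only [shannonEnt_eq_sum_negMulLog, Fintype.sum_prod_type, div_eq_mul_inv,
    Real.negMulLog_mul, Finset.sum_add_distrib, ← Finset.sum_mul, ← Finset.mul_sum, hsum]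
  simp [Real.negMulLog, Real.logb]
  field_simp
  ring

theorem ptrR_diagonal_prod_uniform {lam : Fin d → ℝ} (hsum : ∑ i, lam i = 1) :
    ptrR (Matrix.diagonal fun k : Fin d × Fin d => ((lam k.2 / d : ℝ) : ℂ)) =
      Matrix.diagonal fun _ => (((d : ℝ)⁻¹ : ℝ) : ℂ) := by
  ext i j
  by_cases h : i = j
  · subst h
    have : ∑ b, (lam b : ℂ) = 1 := by exact_mod_cast hsum
    simp [ptrR, ← Finset.sum_div, this]
  · simp [ptrR, h]

theorem assistedOut_eq_erase {p : ℝ} {N : QChannel (Fin d) (Fin d ⊕ Unit)}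
    (hN : ∀ ρ : Matrix (Fin d) (Fin d) ℂ, N.map ρ = Matrix.fromBlocks
      ((1 - (p : ℂ)) • ρ) 0 0 (Matrix.of fun _ _ => (p : ℂ) * ρ.trace))
    (E : QChannel (Fin d) (Fin d)) (ρ : Matrix (Fin d × Fin d) (Fin d × Fin d) ℂ) :
    assistedOut N E ρ = erase p (rTensor (Fin d) E.map ρ) := by
  ext ⟨i | i, b⟩ ⟨j | j, c⟩ <;>
    simp [assistedOut, rTensor, hN, erase, erasureEquiv, ptrL, Matrix.trace]

end ErasureAssisted

/-- for the qudit erasure channel `E_{d,p}` assisted by `Φ_λ`,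
the minimum output entropy over local encodings is `h(p) + p·H(λ)`, and
consequently `χ_{Φ_λ}(E_{d,p}) = I_{Φ_λ}(E_{d,p}) = (1-p)(log d + H(λ))`. -/
theorem erasure_channel_assisted_capacity
    {d : ℕ} (hd : 0 < d) (p : ℝ) (hp : p ∈ Set.Icc (0 : ℝ) 1)
    (lam : Fin d → ℝ) (hlam : ∀ i, 0 ≤ lam i) (hsum : ∑ i, lam i = 1)
    (N : QChannel (Fin d) (Fin d ⊕ Unit))
    (hN : ∀ ρ : Matrix (Fin d) (Fin d) ℂ, N.map ρ = Matrix.of fun a b =>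
      match a, b with
      | Sum.inl i, Sum.inl j => (1 - (p : ℂ)) * ρ i j
      | Sum.inr _, Sum.inr _ => (p : ℂ) * ρ.trace
      | _, _ => 0) :
    sInf { s | ∃ E : QChannel (Fin d) (Fin d),
        s = entropy (assistedOut N E (phiLam lam)) }
      = binEnt p + p * shannonEnt lam ∧
    assistedHolevoS N (phiLam lam) = (1 - p) * (Real.logb 2 d + shannonEnt lam) ∧
    assistedMutualS N (phiLam lam) = (1 - p) * (Real.logb 2 d + shannonEnt lam) := by
  have hN' (ρ : Matrix (Fin d) (Fin d) ℂ) : N.map ρ = Matrix.fromBlocks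
      ((1 - (p : ℂ)) • ρ) 0 0 (Matrix.of fun _ _ => (p : ℂ) * ρ.trace) := by
    rw [hN]
    ext (i | i) (j | j) <;> rfl
  have hne : Nonempty (Fin d) := ⟨⟨0, hd⟩⟩
  have hp' : 0 ≤ 1 - p := sub_nonneg.mpr hp.2
  have hS (E : QChannel (Fin d) (Fin d)) : IsState (rTensor (Fin d) E.map (phiLam lam)) :=
    isState_rTensor E (isState_phiLam hlam hsum)
  have hμ (E : QChannel (Fin d) (Fin d)) : ptrL (rTensor (Fin d) E.map (phiLam lam)) =
      Matrix.diagonal fun i => (lam i : ℂ) := (ptrL_rTensor_s19 E _).trans (ptrL_phiLam hlam)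
  have hout (E : QChannel (Fin d) (Fin d)) : entropy (assistedOut N E (phiLam lam)) =
      binEnt p + (1 - p) * entropy (rTensor (Fin d) E.map (phiLam lam)) + p * shannonEnt lam := by
    rw [assistedOut_eq_erase hN', entropy_erase p (hS E), hμ, entropy_diagonal]
  have hχ {n : ℕ} {q : Fin n → ℝ} (hq : IsProbDist q) (E : Fin n → QChannel (Fin d) (Fin d)) :
      mutualInfoS (assistedCQ N (phiLam lam) q E) = (1 - p) *
        (entropy (∑ x, (q x : ℂ) • rTensor (Fin d) (E x).map (phiLam lam)) -
          ∑ x, q x * entropy (rTensor (Fin d) (E x).map (phiLam lam))) := by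
    rw [assistedCQ]
    simp only [assistedOut_eq_erase hN']
    exact mutualInfoS_cqState_erase p hq (fun x => hS (E x)) fun x => hμ (E x)
  have hI {n : ℕ} {q : Fin n → ℝ} (hq : IsProbDist q) (E : Fin n → QChannel (Fin d) (Fin d)) :
      infoXE_B (assistedCQ N (phiLam lam) q E) = (1 - p) * (shannonEnt lam +
        entropy (ptrR (∑ x, (q x : ℂ) • rTensor (Fin d) (E x).map (phiLam lam))) -
          ∑ x, q x * entropy (rTensor (Fin d) (E x).map (phiLam lam))) := by
    rw [assistedCQ, ← entropy_diagonal]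
    simp only [assistedOut_eq_erase hN']
    exact infoXE_B_cqState_erase p hq (fun x => hS (E x)) fun x => hμ (E x)
  have hnonneg {n : ℕ} {q : Fin n → ℝ} (hq : IsProbDist q)
      (E : Fin n → QChannel (Fin d) (Fin d)) :
      0 ≤ ∑ x, q x * entropy (rTensor (Fin d) (E x).map (phiLam lam)) :=
    Finset.sum_nonneg fun x _ => mul_nonneg (hq.1 x) (entropy_nonneg (hS (E x)))
  obtain ⟨U, hU, hU'⟩ := exists_unitary_error_basis hd
  have hd' : (d : ℝ) ≠ 0 := by exact_mod_cast hd.ne'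
  have hunif : IsProbDist fun _ : Fin (d * d) => (d * d : ℝ)⁻¹ :=
    ⟨fun _ => by positivity, by simp; field_simp⟩
  have havg := sum_smul_rTensor_conjChannel_phiLam hd hlam hU hU'
  refine ⟨IsLeast.csInf_eq ⟨⟨conjChannel 1 (by simp), ?_⟩, ?_⟩,
    IsGreatest.csSup_eq ⟨⟨d * d, _, fun x => conjChannel (U x) (hU x), hunif, ?_⟩, ?_⟩,
    IsGreatest.csSup_eq ⟨⟨d * d, _, fun x => conjChannel (U x) (hU x), hunif, ?_⟩, ?_⟩⟩
  · rw [hout, entropy_rTensor_conjChannel_phiLam hlam hsum]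
    ring
  · rintro _ ⟨E, rfl⟩
    rw [hout]
    linarith [mul_nonneg hp' (entropy_nonneg (hS E))]
  · rw [hχ hunif, havg, entropy_diagonal, shannonEnt_prod_uniform hd hsum]
    simp [entropy_rTensor_conjChannel_phiLam hlam hsum]
  · rintro _ ⟨n, q, E, hq, rfl⟩
    rw [hχ hq]
    refine mul_le_mul_of_nonneg_left ?_ hp'
    have hm : ptrL (∑ x, (q x : ℂ) • rTensor (Fin d) (E x).map (phiLam lam)) =
        Matrix.diagonal fun i => (lam i : ℂ) := by
      rw [ptrL_sum_smul]
      simp only [hμ, ← Finset.sum_smul, ← Complex.ofReal_sum, hq.2, Complex.ofReal_one, one_smul]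
    have := entropy_le_of_ptrL_eq_diagonal (isState_sum_smul hq fun x => hS (E x)).1 hsum hm
    rw [Fintype.card_fin] at this
    linarith [hnonneg hq E]
  · rw [hI hunif, havg, ptrR_diagonal_prod_uniform hsum, entropy_diagonal, shannonEnt_uniform hd]
    simp [entropy_rTensor_conjChannel_phiLam hlam hsum, add_comm]
  · rintro _ ⟨n, q, E, hq, rfl⟩
    rw [hI hq]
    refine mul_le_mul_of_nonneg_left ?_ hp'
    have := entropy_le_logb_card (isState_ptrR (isState_sum_smul hq fun x => hS (E x)))
    rw [Fintype.card_fin] at this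
    linarith [hnonneg hq E]

end QIT
end
end
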